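/- Let U : ℝ² → ℝ² be continuously differentiable with DU ℤ²-periodic and det⟨DU⟩ ≠ 0. Suppose σ : ℝ² → ℝ^{2×2} is infinitely differentiable, ℤ²-periodic, symmetric, pointwise positive definite, and Div(σDU) = 0 in the sense of distributions on ℝ², i.e. for each j = 1,2, ∫_{ℝ²} (σ∇U_j) · ∇φ dx = 0 for all φ ∈ C_c^∞(ℝ²). Then det(⟨DU⟩ · DU(x)) > 0 for every x ∈ ℝ². (Theorem 3.1(ii): in dimension two, a realizable periodic matrix electric field has pointwise positive determinant.) -/

import Mathlib

open MeasureTheory Matrix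

/-- The matrix-valued electric field `DU(x) = [∂U_j/∂x_i]`, whose `j`-th column is `∇U_j`. -/
noncomputable def matGrad (U : EuclideanSpace ℝ (Fin 2) → EuclideanSpace ℝ (Fin 2))
    (x : EuclideanSpace ℝ (Fin 2)) : Matrix (Fin 2) (Fin 2) ℝ :=
  Matrix.of fun i j => fderiv ℝ (fun y => U y j) x (EuclideanSpace.single i 1)

/-- A function on the plane that is `ℤ²`-periodic. -/
def IsPlanePeriodic {α : Type*} (f : ℝ × ℝ → α) : Prop :=
  ∀ x y, f (x + 1, y) = f (x, y) ∧ f (x, y + 1) = f (x, y)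

/-- The integral over the unit cell. -/
noncomputable def cellInt {E : Type*} [NormedAddCommGroup E] [NormedSpace ℝ E]
    (f : ℝ × ℝ → E) : E :=
  ∫ z in Set.Ioc (0 : ℝ) 1 ×ˢ Set.Ioc (0 : ℝ) 1, f z

/-- The first partial derivative. -/
noncomputable def dx (f : ℝ × ℝ → ℝ) (z : ℝ × ℝ) : ℝ := fderiv ℝ f z (1, 0)

/-- The second partial derivative. -/
noncomputable def dy (f : ℝ × ℝ → ℝ) (z : ℝ × ℝ) : ℝ := fderiv ℝ f z (0, 1)

section Cell

lemma Continuous.integrableOn_cell {E : Type*} [NormedAddCommGroup E] {f : ℝ × ℝ → E}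
    (hf : Continuous f) :
    IntegrableOn f (Set.Ioc (0 : ℝ) 1 ×ˢ Set.Ioc (0 : ℝ) 1) :=
  (hf.continuousOn.integrableOn_compact (isCompact_Icc.prod isCompact_Icc)).mono_set
    (Set.prod_mono Set.Ioc_subset_Icc_self Set.Ioc_subset_Icc_self)

variable {E : Type*} [NormedAddCommGroup E] [NormedSpace ℝ E]

lemma cellInt_eq_iterated {f : ℝ × ℝ → E} (hf : Continuous f) :
    cellInt f = ∫ x in (0 : ℝ)..1, ∫ y in (0 : ℝ)..1, f (x, y) := by
  simp only [intervalIntegral.integral_of_le zero_le_one]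
  exact setIntegral_prod _ hf.integrableOn_cell

lemma cellInt_eq_iterated_swap {f : ℝ × ℝ → E} (hf : Continuous f) :
    cellInt f = ∫ y in (0 : ℝ)..1, ∫ x in (0 : ℝ)..1, f (x, y) := by
  have h := setIntegral_prod_swap (μ := (volume : Measure ℝ)) (ν := (volume : Measure ℝ))
    (Set.Ioc (0 : ℝ) 1) (Set.Ioc (0 : ℝ) 1) f
  exact h.symm.trans (cellInt_eq_iterated (f := fun z => f z.swap) (by fun_prop))

lemma cellInt_mono {f g : ℝ × ℝ → ℝ} (hf : Continuous f) (hg : Continuous g)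
    (h : ∀ z, f z ≤ g z) : cellInt f ≤ cellInt g :=
  setIntegral_mono hf.integrableOn_cell hg.integrableOn_cell h

lemma cellInt_add {f g : ℝ × ℝ → E} (hf : Continuous f) (hg : Continuous g) :
    cellInt (fun z => f z + g z) = cellInt f + cellInt g :=
  integral_add hf.integrableOn_cell hg.integrableOn_cell

lemma cellInt_sub {f g : ℝ × ℝ → E} (hf : Continuous f) (hg : Continuous g) :
    cellInt (fun z => f z - g z) = cellInt f - cellInt g :=
  integral_sub hf.integrableOn_cell hg.integrableOn_cell

lemma cellInt_const_mul (c : ℝ) (f : ℝ × ℝ → ℝ) :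
    cellInt (fun z => c * f z) = c * cellInt f :=
  integral_const_mul _ _

lemma cellInt_const (c : ℝ) : cellInt (fun _ => c) = c := by
  rw [cellInt_eq_iterated continuous_const]; simp

end Cell

section Partial

variable {f : ℝ × ℝ → ℝ}

lemma continuous_dx (hf : ContDiff ℝ 1 f) : Continuous (dx f) :=
  (hf.continuous_fderiv one_ne_zero).clm_apply continuous_const

lemma continuous_dy (hf : ContDiff ℝ 1 f) : Continuous (dy f) :=
  (hf.continuous_fderiv one_ne_zero).clm_apply continuous_const

lemma fderiv_eq_dx_dy (f : ℝ × ℝ → ℝ) (z : ℝ × ℝ) (s t : ℝ) :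
    fderiv ℝ f z (s, t) = s * dx f z + t * dy f z := by
  have : ((s, t) : ℝ × ℝ) = s • (1, 0) + t • (0, 1) := by simp
  rw [this, map_add, map_smul, map_smul]
  rfl

lemma hasDerivAt_line {z : ℝ × ℝ} (hf : DifferentiableAt ℝ f z) {γ₁ γ₂ : ℝ → ℝ} {s v₁ v₂ : ℝ}
    (h₁ : HasDerivAt γ₁ v₁ s) (h₂ : HasDerivAt γ₂ v₂ s) (hz : (γ₁ s, γ₂ s) = z) :
    HasDerivAt (fun s => f (γ₁ s, γ₂ s)) (v₁ * dx f z + v₂ * dy f z) s := by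
  subst hz
  rw [← fderiv_eq_dx_dy]
  exact hf.hasFDerivAt.comp_hasDerivAt s (h₁.prodMk h₂)

lemma hasDerivAt_dx (hf : ContDiff ℝ 1 f) (x y : ℝ) :
    HasDerivAt (fun s => f (s, y)) (dx f (x, y)) x := by
  simpa using hasDerivAt_line ((hf.differentiable one_ne_zero) (x, y)) (hasDerivAt_id x)
    (hasDerivAt_const x y) rfl

lemma hasDerivAt_dy (hf : ContDiff ℝ 1 f) (x y : ℝ) :
    HasDerivAt (fun s => f (x, s)) (dy f (x, y)) y := by
  simpa using hasDerivAt_line ((hf.differentiable one_ne_zero) (x, y)) (hasDerivAt_const y x)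
    (hasDerivAt_id y) rfl

lemma dx_eq_of_hasDerivAt (hf : DifferentiableAt ℝ f (z : ℝ × ℝ)) {v : ℝ}
    (h : HasDerivAt (fun s => f (s, z.2)) v z.1) : dx f z = v := by
  have := hasDerivAt_line hf (hasDerivAt_id z.1) (hasDerivAt_const z.1 z.2) rfl
  simpa using this.unique h

lemma dy_eq_of_hasDerivAt (hf : DifferentiableAt ℝ f (z : ℝ × ℝ)) {v : ℝ}
    (h : HasDerivAt (fun s => f (z.1, s)) v z.2) : dy f z = v := by
  have := hasDerivAt_line hf (hasDerivAt_const z.2 z.1) (hasDerivAt_id z.2) rfl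
  simpa using this.unique h

lemma isPlanePeriodic_fderiv (hf : IsPlanePeriodic f) : IsPlanePeriodic (fderiv ℝ f) := by
  intro x y
  constructor
  · have h : (fun z => f (z + (1, 0))) = f := by
      ext ⟨a, b⟩; simpa using (hf a b).1
    have := fderiv_comp_add_right (𝕜 := ℝ) (f := f) (x := (x, y)) (1, 0)
    rw [h] at this; rw [this]; simp
  · have h : (fun z => f (z + (0, 1))) = f := by
      ext ⟨a, b⟩; simpa using (hf a b).2
    have := fderiv_comp_add_right (𝕜 := ℝ) (f := f) (x := (x, y)) (0, 1)
    rw [h] at this; rw [this]; simp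

lemma isPlanePeriodic_dx (hf : IsPlanePeriodic f) : IsPlanePeriodic (dx f) := fun x y =>
  ⟨by rw [dx, (isPlanePeriodic_fderiv hf x y).1, dx],
    by rw [dx, (isPlanePeriodic_fderiv hf x y).2, dx]⟩

lemma isPlanePeriodic_dy (hf : IsPlanePeriodic f) : IsPlanePeriodic (dy f) := fun x y =>
  ⟨by rw [dy, (isPlanePeriodic_fderiv hf x y).1, dy],
    by rw [dy, (isPlanePeriodic_fderiv hf x y).2, dy]⟩

lemma cellInt_dx (hf : ContDiff ℝ 1 f) (hp : IsPlanePeriodic f) : cellInt (dx f) = 0 := by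
  rw [cellInt_eq_iterated_swap (continuous_dx hf)]
  have : ∀ y : ℝ, ∫ x in (0 : ℝ)..1, dx f (x, y) = 0 := fun y => by
    rw [intervalIntegral.integral_eq_sub_of_hasDerivAt (fun x _ => hasDerivAt_dx hf x y)
      ((Continuous.comp (continuous_dx hf) (by fun_prop)).intervalIntegrable _ _)]
    have := (hp 0 y).1
    simp at this
    simp [this]
  simp [this]

lemma cellInt_dy (hf : ContDiff ℝ 1 f) (hp : IsPlanePeriodic f) : cellInt (dy f) = 0 := by
  rw [cellInt_eq_iterated (continuous_dy hf)]
  have : ∀ x : ℝ, ∫ y in (0 : ℝ)..1, dy f (x, y) = 0 := fun x => by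
    rw [intervalIntegral.integral_eq_sub_of_hasDerivAt (fun y _ => hasDerivAt_dy hf x y)
      ((Continuous.comp (continuous_dy hf) (by fun_prop)).intervalIntegrable _ _)]
    have := (hp x 0).2
    simp at this
    simp [this]
  simp [this]

end Partial

section Shift

variable {f : ℝ × ℝ → ℝ}

lemma IsPlanePeriodic.periodic_snd {α : Type*} {f : ℝ × ℝ → α} (hp : IsPlanePeriodic f) (x : ℝ) :
    Function.Periodic (fun y => f (x, y)) 1 := fun y => (hp x y).2

lemma IsPlanePeriodic.periodic_fst {α : Type*} {f : ℝ × ℝ → α} (hp : IsPlanePeriodic f) (y : ℝ) :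
    Function.Periodic (fun x => f (x, y)) 1 := fun x => (hp x y).1

lemma IsPlanePeriodic.cell_shift {E : Type*} [NormedAddCommGroup E] [NormedSpace ℝ E]
    {f : ℝ × ℝ → E} (hf : Continuous f) (hp : IsPlanePeriodic f) (s t : ℝ) :
    ∫ x in s..s + 1, ∫ y in t..t + 1, f (x, y) = cellInt f := by
  rw [cellInt_eq_iterated hf]
  have h : ∀ x : ℝ, ∫ y in t..t + 1, f (x, y) = ∫ y in (0 : ℝ)..1, f (x, y) := fun x => by
    simpa using (hp.periodic_snd x).intervalIntegral_add_eq t 0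
  simp only [h]
  have : Function.Periodic (fun x : ℝ => ∫ y in (0 : ℝ)..1, f (x, y)) 1 := fun x => by
    simp only [(hp _ _).1]
  simpa using this.intervalIntegral_add_eq s 0

lemma IsPlanePeriodic.cell_shift_swap (hf : Continuous f) (hp : IsPlanePeriodic f) (s t : ℝ) :
    ∫ y in t..t + 1, ∫ x in s..s + 1, f (x, y) = cellInt f := by
  rw [cellInt_eq_iterated_swap hf]
  have h : ∀ y : ℝ, ∫ x in s..s + 1, f (x, y) = ∫ x in (0 : ℝ)..1, f (x, y) := fun y => by
    simpa using (hp.periodic_fst y).intervalIntegral_add_eq s 0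
  simp only [h]
  have : Function.Periodic (fun y : ℝ => ∫ x in (0 : ℝ)..1, f (x, y)) 1 := fun y => by
    simp only [(hp _ _).2]
  simpa using this.intervalIntegral_add_eq t 0

end Shift

section LogEnergy

variable {g : ℝ × ℝ → ℝ}

/-- The squared length of the gradient. -/
noncomputable def gradSq (g : ℝ × ℝ → ℝ) (z : ℝ × ℝ) : ℝ := dx g z ^ 2 + dy g z ^ 2

lemma continuous_gradSq (hg : ContDiff ℝ 1 g) : Continuous (gradSq g) :=
  ((continuous_dx hg).pow 2).add ((continuous_dy hg).pow 2)

lemma isPlanePeriodic_gradSq (hp : IsPlanePeriodic g) : IsPlanePeriodic (gradSq g) := fun x y =>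
  ⟨by simp only [gradSq, (isPlanePeriodic_dx hp x y).1, (isPlanePeriodic_dy hp x y).1],
    by simp only [gradSq, (isPlanePeriodic_dx hp x y).2, (isPlanePeriodic_dy hp x y).2]⟩

lemma gradSq_nonneg (g : ℝ × ℝ → ℝ) (z : ℝ × ℝ) : 0 ≤ gradSq g z := by
  unfold gradSq; positivity

/-- Comparison of the mean over a vertical segment with the mean over a small parallel segment,
along the cone joining both to a point. -/
lemma cone_estimate (hg : ContDiff ℝ 1 g) (hp : IsPlanePeriodic g) (x₀ y₀ : ℝ) {δ : ℝ}
    (hδ : 0 < δ) (hδ1 : δ ≤ 1) :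
    (∫ t in (-1 : ℝ)..1, g (x₀ + 1, y₀ + t)) - ∫ t in (-1 : ℝ)..1, g (x₀ + δ, y₀ + δ * t) ≤
      2 * cellInt (gradSq g) - Real.log δ := by
  have hW := continuous_gradSq hg
  have hWp := isPlanePeriodic_gradSq hp
  have hgc := hg.continuous
  set D : ℝ → ℝ → ℝ := fun s t => dx g (x₀ + s, y₀ + s * t) + t * dy g (x₀ + s, y₀ + s * t)
  have hDc : Continuous (Function.uncurry D) := by
    have h1 := continuous_dx hg
    have h2 := continuous_dy hg
    unfold D Function.uncurry
    fun_prop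
  have hFTC : ∀ t : ℝ, ∫ s in δ..1, D s t = g (x₀ + 1, y₀ + t) - g (x₀ + δ, y₀ + δ * t) := by
    intro t
    rw [intervalIntegral.integral_eq_sub_of_hasDerivAt
      (f := fun s => g (x₀ + s, y₀ + s * t)) (f' := fun s => D s t)]
    · simp
    · intro s _
      have := hasDerivAt_line (f := g) (z := (x₀ + s, y₀ + s * t))
        ((hg.differentiable one_ne_zero) _) ((hasDerivAt_id s).const_add x₀)
        (((hasDerivAt_id s).mul_const t).const_add y₀) rfl
      simpa [D] using this
    · exact (hDc.comp (by fun_prop : Continuous fun s : ℝ => (s, t))).intervalIntegrable _ _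
  have hpt : ∀ s t : ℝ, 0 < s → t ^ 2 ≤ 1 →
      D s t ≤ s * gradSq g (x₀ + s, y₀ + s * t) + 1 / (2 * s) := by
    intro s t hs ht
    have h1 : D s t ^ 2 ≤ 2 * gradSq g (x₀ + s, y₀ + s * t) := by
      simp only [D, gradSq]
      nlinarith [sq_nonneg (dx g (x₀ + s, y₀ + s * t) * t - dy g (x₀ + s, y₀ + s * t)),
        sq_nonneg (dx g (x₀ + s, y₀ + s * t)), sq_nonneg (dy g (x₀ + s, y₀ + s * t))]
    have h2 : D s t ≤ s * D s t ^ 2 / 2 + 1 / (2 * s) := by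
      have : s * D s t ^ 2 / 2 + 1 / (2 * s) - D s t = (s * D s t - 1) ^ 2 / (2 * s) := by
        field_simp; ring
      have h3 : 0 ≤ (s * D s t - 1) ^ 2 / (2 * s) := by positivity
      linarith
    nlinarith
  have hinner : ∀ s ∈ Set.Icc δ 1, ∫ t in (-1 : ℝ)..1, D s t ≤
      2 * (∫ y in (y₀)..y₀ + 1, gradSq g (x₀ + s, y)) + 1 / s := by
    intro s hs
    have hs0 : 0 < s := hδ.trans_le hs.1
    have hWs : Continuous fun y => gradSq g (x₀ + s, y) := by fun_prop
    have hWst : Continuous fun t => gradSq g (x₀ + s, y₀ + s * t) := by fun_prop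
    calc ∫ t in (-1 : ℝ)..1, D s t
        ≤ ∫ t in (-1 : ℝ)..1, (s * gradSq g (x₀ + s, y₀ + s * t) + 1 / (2 * s)) := by
          apply intervalIntegral.integral_mono_on (by norm_num)
          · exact (hDc.comp (by fun_prop : Continuous fun t : ℝ => (s, t))).intervalIntegrable _ _
          · exact Continuous.intervalIntegrable (by fun_prop) _ _
          · intro t ht
            exact hpt s t hs0 (by nlinarith [ht.1, ht.2])
      _ = (∫ y in (y₀ - s)..(y₀ + s), gradSq g (x₀ + s, y)) + 1 / s := by
          rw [intervalIntegral.integral_add (Continuous.intervalIntegrable (by fun_prop) _ _)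
            (by simp), intervalIntegral.integral_const_mul]
          have := intervalIntegral.smul_integral_comp_mul_add (a := -1) (b := 1)
            (fun y => gradSq g (x₀ + s, y)) s y₀
          simp only [smul_eq_mul] at this
          simp only [add_comm y₀, this]
          simp only [mul_neg, mul_one, neg_add_eq_sub, intervalIntegral.integral_const, smul_eq_mul,
            add_comm s y₀]
          congr 1
          field_simp; norm_num
      _ ≤ (∫ y in (y₀ - 1)..(y₀ + 1), gradSq g (x₀ + s, y)) + 1 / s := by
          gcongr
          apply intervalIntegral.integral_mono_interval
          · linarith [hs.2]
          · linarith
          · linarith [hs.2]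
          · exact Filter.Eventually.of_forall fun y => gradSq_nonneg _ _
          · exact hWs.intervalIntegrable _ _
      _ = _ := by
          rw [← intervalIntegral.integral_add_adjacent_intervals (b := y₀)
            (hWs.intervalIntegrable _ _) (hWs.intervalIntegrable _ _)]
          have := (hWp.periodic_snd (x₀ + s)).intervalIntegral_add_eq (y₀ - 1) y₀
          rw [sub_add_cancel] at this
          rw [this]; ring
  have hh : Continuous fun x => ∫ y in (y₀)..y₀ + 1, gradSq g (x, y) :=
    intervalIntegral.continuous_parametric_intervalIntegral_of_continuous' (by
      unfold Function.uncurry; fun_prop) _ _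
  have h0 : ∀ x, 0 ≤ ∫ y in (y₀)..y₀ + 1, gradSq g (x, y) := fun x =>
    intervalIntegral.integral_nonneg (by linarith) fun y _ => gradSq_nonneg _ _
  have hinv : IntervalIntegrable (fun s : ℝ => 1 / s) volume δ 1 := by
    apply intervalIntegral.intervalIntegrable_one_div
    · intro x hx
      rw [Set.uIcc_of_le hδ1] at hx
      exact (hδ.trans_le hx.1).ne'
    · fun_prop
  calc (∫ t in (-1 : ℝ)..1, g (x₀ + 1, y₀ + t)) - ∫ t in (-1 : ℝ)..1, g (x₀ + δ, y₀ + δ * t)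
      = ∫ t in (-1 : ℝ)..1, ∫ s in δ..1, D s t := by
        simp only [hFTC]
        rw [intervalIntegral.integral_sub] <;> exact Continuous.intervalIntegrable (by fun_prop) _ _
    _ = ∫ s in δ..1, ∫ t in (-1 : ℝ)..1, D s t := by
        apply intervalIntegral_intervalIntegral_swap
        refine ((Continuous.continuousOn (s := Set.uIcc (-1) 1 ×ˢ Set.uIcc δ 1)
          ?_).integrableOn_compact
          (isCompact_uIcc.prod isCompact_uIcc)).mono_set
          (Set.prod_mono Set.uIoc_subset_uIcc Set.uIoc_subset_uIcc)
        exact hDc.comp continuous_swap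
    _ ≤ ∫ s in δ..1, (2 * (∫ y in (y₀)..y₀ + 1, gradSq g (x₀ + s, y)) + 1 / s) := by
        apply intervalIntegral.integral_mono_on hδ1 _ _ hinner
        · exact (intervalIntegral.continuous_parametric_intervalIntegral_of_continuous'
            hDc _ _).intervalIntegrable _ _
        · exact (Continuous.intervalIntegrable (by fun_prop) _ _).add hinv
    _ = 2 * (∫ s in δ..1, ∫ y in (y₀)..y₀ + 1, gradSq g (x₀ + s, y)) - Real.log δ := by
        rw [intervalIntegral.integral_add (Continuous.intervalIntegrable (by fun_prop) _ _) hinv,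
          intervalIntegral.integral_const_mul, integral_one_div_of_pos hδ one_pos]
        simp [Real.log_inv]; ring
    _ ≤ _ := by
        gcongr
        rw [← hWp.cell_shift hW x₀ y₀]
        calc ∫ s in δ..1, ∫ y in (y₀)..y₀ + 1, gradSq g (x₀ + s, y)
            ≤ ∫ s in (0 : ℝ)..1, ∫ y in (y₀)..y₀ + 1, gradSq g (x₀ + s, y) := by
              apply intervalIntegral.integral_mono_interval hδ.le hδ1 le_rfl
              · exact Filter.Eventually.of_forall fun y => h0 _
              · exact Continuous.intervalIntegrable (by fun_prop) _ _
          _ = _ := by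
              rw [intervalIntegral.integral_comp_add_left
                (fun x => ∫ y in (y₀)..y₀ + 1, gradSq g (x, y))]
              simp

/-- The mean over a vertical period. -/
noncomputable def columnMean (g : ℝ × ℝ → ℝ) (x : ℝ) : ℝ := ∫ y in (0 : ℝ)..1, g (x, y)

lemma le_add_integral_of_hasDerivAt {φ φ' W : ℝ → ℝ} (h : ∀ s, HasDerivAt φ (φ' s) s)
    (hφ' : Continuous φ') (hW : Continuous W) (hle : ∀ s, |φ' s| ≤ W s) {s z : ℝ}
    (hz : z ∈ Set.Icc s (s + 1)) : |φ s - φ z| ≤ ∫ r in s..s + 1, W r := by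
  have h1 : φ z - φ s = ∫ r in s..z, φ' r :=
    (intervalIntegral.integral_eq_sub_of_hasDerivAt (fun r _ => h r)
      (hφ'.intervalIntegrable _ _)).symm
  rw [abs_sub_comm, h1]
  calc |∫ r in s..z, φ' r| ≤ ∫ r in s..z, |φ' r| :=
        intervalIntegral.abs_integral_le_integral_abs hz.1
    _ ≤ ∫ r in s..z, W r := intervalIntegral.integral_mono_on hz.1
        (hφ'.abs.intervalIntegrable _ _) (hW.intervalIntegrable _ _) fun r _ => hle r
    _ ≤ _ := intervalIntegral.integral_mono_interval le_rfl hz.1 hz.2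
        (Filter.Eventually.of_forall fun r => (abs_nonneg _).trans (hle r))
        (hW.intervalIntegrable _ _)

lemma abs_dx_le (g : ℝ × ℝ → ℝ) (z : ℝ × ℝ) : |dx g z| ≤ 1 + gradSq g z := by
  unfold gradSq
  rw [abs_le]; constructor <;>
    nlinarith [sq_nonneg (dx g z - 1), sq_nonneg (dx g z + 1), sq_nonneg (dy g z)]

lemma abs_dy_le (g : ℝ × ℝ → ℝ) (z : ℝ × ℝ) : |dy g z| ≤ 1 + gradSq g z := by
  unfold gradSq
  rw [abs_le]; constructor <;>
    nlinarith [sq_nonneg (dy g z - 1), sq_nonneg (dy g z + 1), sq_nonneg (dx g z)]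

lemma columnMean_sub_le (hg : ContDiff ℝ 1 g) (hp : IsPlanePeriodic g) (s t : ℝ) :
    columnMean g s ≤ columnMean g t + (1 + cellInt (gradSq g)) := by
  have hW := continuous_gradSq hg
  have hWp := isPlanePeriodic_gradSq hp
  have hgc := hg.continuous
  have hper : Function.Periodic (columnMean g) 1 := fun x => by simp only [columnMean, (hp _ _).1]
  obtain ⟨z, hz, hzt⟩ := hper.exists_mem_Ico one_pos t s
  rw [hzt, ← sub_le_iff_le_add']
  have hz' : z ∈ Set.Icc s (s + 1) := ⟨hz.1, hz.2.le⟩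
  have hc : Continuous fun z => 1 + gradSq g z := by fun_prop
  have hcp : IsPlanePeriodic fun z => 1 + gradSq g z := fun x y => by
    simp only [(hWp x y).1, (hWp x y).2, and_self]
  calc columnMean g s - columnMean g z = ∫ y in (0 : ℝ)..1, (g (s, y) - g (z, y)) := by
        rw [intervalIntegral.integral_sub] <;>
          first | rfl | exact Continuous.intervalIntegrable (by fun_prop) _ _
    _ ≤ ∫ y in (0 : ℝ)..0 + 1, ∫ x in s..s + 1, (1 + gradSq g (x, y)) := by
        rw [zero_add]
        apply intervalIntegral.integral_mono_on zero_le_one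
        · exact Continuous.intervalIntegrable (by fun_prop) _ _
        · exact (intervalIntegral.continuous_parametric_intervalIntegral_of_continuous' (by
            unfold Function.uncurry; fun_prop) _ _).intervalIntegrable _ _
        · intro y _
          have := continuous_dx hg
          exact (le_abs_self _).trans (le_add_integral_of_hasDerivAt (hasDerivAt_dx hg · y)
            (by fun_prop) (by fun_prop) (fun x => abs_dx_le g (x, y)) hz')
    _ = 1 + cellInt (gradSq g) := by
        rw [hcp.cell_shift_swap hc, cellInt_add continuous_const hW, cellInt_const]

lemma le_columnMean_add (hg : ContDiff ℝ 1 g) (hp : IsPlanePeriodic g) (x y : ℝ) :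
    g (x, y) ≤ columnMean g x + ∫ t in (0 : ℝ)..1, (1 + gradSq g (x, t)) := by
  have hW := continuous_gradSq hg
  have hWp := isPlanePeriodic_gradSq hp
  have hgc := hg.continuous
  have h1 : ∫ t in (0 : ℝ)..1, (1 + gradSq g (x, t)) = ∫ t in y..y + 1, (1 + gradSq g (x, t)) := by
    have : Function.Periodic (fun t => 1 + gradSq g (x, t)) 1 := fun t => by
      simp only [(hWp x t).2]
    simpa using this.intervalIntegral_add_eq 0 y
  have h2 : columnMean g x = ∫ t in y..y + 1, g (x, t) := by
    simpa [columnMean] using (hp.periodic_snd x).intervalIntegral_add_eq 0 y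
  rw [h1, h2]
  set K := ∫ t in y..y + 1, (1 + gradSq g (x, t))
  have h3 : ∀ t ∈ Set.Icc y (y + 1), g (x, y) - K ≤ g (x, t) := fun t ht => by
    have := continuous_dy hg
    have := (le_abs_self _).trans (le_add_integral_of_hasDerivAt (hasDerivAt_dy hg x ·)
            (by fun_prop) (by fun_prop) (fun y => abs_dy_le g (x, y)) ht)
    linarith
  have h4 := intervalIntegral.integral_mono_on (a := y) (b := y + 1) (μ := volume)
    (f := fun _ => g (x, y) - K) (g := fun t => g (x, t)) (by linarith)
    intervalIntegrable_const (Continuous.intervalIntegrable (by fun_prop) _ _) h3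
  rw [intervalIntegral.integral_const, add_sub_cancel_left, one_smul] at h4
  linarith

/-- A lower bound on a horizontal segment gives a lower bound for all column means. -/
lemma columnMean_lower_bound (hg : ContDiff ℝ 1 g) (hp : IsPlanePeriodic g) {x₁ y₁ r c : ℝ}
    (hr : 0 < r) (hr1 : r ≤ 1) (hc : ∀ s ∈ Set.Icc x₁ (x₁ + r), c ≤ g (s, y₁)) (t : ℝ) :
    c ≤ columnMean g t + (1 + 1 / r) * (1 + cellInt (gradSq g)) := by
  have hW := continuous_gradSq hg
  have hWp := isPlanePeriodic_gradSq hp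
  have hc' : Continuous fun z => 1 + gradSq g z := by fun_prop
  have hcp : IsPlanePeriodic fun z => 1 + gradSq g z := fun x y => by
    simp only [(hWp x y).1, (hWp x y).2, and_self]
  set K := 1 + cellInt (gradSq g) with hK
  have hcont : Continuous fun s => ∫ y in (0 : ℝ)..1, (1 + gradSq g (s, y)) :=
    intervalIntegral.continuous_parametric_intervalIntegral_of_continuous' (by
      unfold Function.uncurry; fun_prop) _ _
  have h1 : ∫ s in x₁..x₁ + r, c ≤
      ∫ s in x₁..x₁ + r, (columnMean g t + K + ∫ y in (0 : ℝ)..1, (1 + gradSq g (s, y))) := by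
    apply intervalIntegral.integral_mono_on (by linarith) (by simp)
    · exact (continuous_const.add hcont).intervalIntegrable _ _
    · intro s hs
      have := columnMean_sub_le hg hp s t
      have := le_columnMean_add hg hp s y₁
      linarith [hc s hs]
  have h2 : ∫ s in x₁..x₁ + r, ∫ y in (0 : ℝ)..1, (1 + gradSq g (s, y)) ≤ K := by
    have : K = ∫ s in x₁..x₁ + 1, ∫ y in (0 : ℝ)..0 + 1, (1 + gradSq g (s, y)) := by
      rw [hcp.cell_shift hc', cellInt_add continuous_const hW, cellInt_const]
    rw [this, zero_add]
    apply intervalIntegral.integral_mono_interval le_rfl (by linarith) (by linarith)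
    · exact Filter.Eventually.of_forall fun s => intervalIntegral.integral_nonneg zero_le_one
        fun y _ => by simpa using add_nonneg zero_le_one (gradSq_nonneg g (s, y))
    · exact hcont.intervalIntegrable _ _
  rw [intervalIntegral.integral_add (by simp) (hcont.intervalIntegrable _ _)] at h1
  simp at h1
  have h3 : r * c ≤ r * (columnMean g t + K + K / r) := by
    have : r * (columnMean g t + K + K / r) = r * (columnMean g t + K) + K := by field_simp
    linarith
  have h4 := le_of_mul_le_mul_left h3 hr
  calc c ≤ _ := h4
    _ = _ := by ring

end LogEnergy

section Vanishing

variable {p q : ℝ × ℝ → ℝ}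

/-- The regularised logarithm of the squared length of the field `(p, q)`. -/
noncomputable def logSq (p q : ℝ × ℝ → ℝ) (ε : ℝ) (z : ℝ × ℝ) : ℝ :=
  Real.log (p z ^ 2 + q z ^ 2 + ε ^ 2)

lemma logSq_arg_pos {ε : ℝ} (hε : 0 < ε) (z : ℝ × ℝ) : 0 < p z ^ 2 + q z ^ 2 + ε ^ 2 := by
  positivity

lemma contDiff_logSq {n : ℕ∞} (hp : ContDiff ℝ n p) (hq : ContDiff ℝ n q) {ε : ℝ} (hε : 0 < ε) :
    ContDiff ℝ n (logSq p q ε) :=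
  ((((hp.pow 2).add (hq.pow 2)).add contDiff_const).log fun z => (logSq_arg_pos hε z).ne')

lemma gradSq_logSq_le (hp : ContDiff ℝ 1 p) (hq : ContDiff ℝ 1 q) {ε : ℝ} (hε : 0 < ε)
    (z : ℝ × ℝ) :
    gradSq (logSq p q ε) z ≤ 4 * ((gradSq p z + gradSq q z) / (p z ^ 2 + q z ^ 2 + ε ^ 2)) := by
  have hpos := logSq_arg_pos (p := p) (q := q) hε z
  have hd := (contDiff_logSq (n := 1) hp hq hε).differentiable one_ne_zero z
  have h1 : dx (logSq p q ε) z =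
      (2 * p z * dx p z + 2 * q z * dx q z) / (p z ^ 2 + q z ^ 2 + ε ^ 2) := by
    apply dx_eq_of_hasDerivAt hd
    have := ((((hasDerivAt_dx hp z.1 z.2).pow 2).add ((hasDerivAt_dx hq z.1 z.2).pow 2)).add_const
      (ε ^ 2)).log hpos.ne'
    simpa [logSq] using this
  have h2 : dy (logSq p q ε) z =
      (2 * p z * dy p z + 2 * q z * dy q z) / (p z ^ 2 + q z ^ 2 + ε ^ 2) := by
    apply dy_eq_of_hasDerivAt hd
    have := ((((hasDerivAt_dy hp z.1 z.2).pow 2).add ((hasDerivAt_dy hq z.1 z.2).pow 2)).add_const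
      (ε ^ 2)).log hpos.ne'
    simpa [logSq] using this
  set r := p z ^ 2 + q z ^ 2 + ε ^ 2 with hr
  unfold gradSq
  rw [h1, h2, div_pow, div_pow, ← add_div, ← mul_div_assoc, div_le_div_iff₀ (by positivity) hpos]
  have h3 : (2 * p z * dx p z + 2 * q z * dx q z) ^ 2 + (2 * p z * dy p z + 2 * q z * dy q z) ^ 2
      ≤ 4 * (dx p z ^ 2 + dy p z ^ 2 + (dx q z ^ 2 + dy q z ^ 2)) * r := by
    rw [hr]
    nlinarith [sq_nonneg (p z * dx q z - q z * dx p z), sq_nonneg (p z * dy q z - q z * dy p z),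
      mul_nonneg (by positivity : 0 ≤ dx p z ^ 2 + dy p z ^ 2 + (dx q z ^ 2 + dy q z ^ 2))
        (sq_nonneg ε)]
  calc _ ≤ 4 * (dx p z ^ 2 + dy p z ^ 2 + (dx q z ^ 2 + dy q z ^ 2)) * r * r := by gcongr
    _ = _ := by ring

/-- If the logarithm of the length of a periodic field has finite Dirichlet energy, then a single
zero of the field forces it to vanish identically. -/
theorem eq_zero_of_logSq_energy_bound (hp : ContDiff ℝ 1 p) (hq : ContDiff ℝ 1 q)
    (hpp : IsPlanePeriodic p) (hqp : IsPlanePeriodic q) {M : ℝ}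
    (hM : ∀ ε > 0, cellInt (gradSq (logSq p q ε)) ≤ M)
    {z₀ : ℝ × ℝ} (hp0 : p z₀ = 0) (hq0 : q z₀ = 0) (z₁ : ℝ × ℝ) : p z₁ = 0 ∧ q z₁ = 0 := by
  by_contra hne
  obtain ⟨x₀, y₀⟩ := z₀
  obtain ⟨x₁, y₁⟩ := z₁
  have hpc := hp.continuous
  have hqc := hq.continuous
  have hpos : 0 < p (x₁, y₁) ^ 2 + q (x₁, y₁) ^ 2 := by
    by_contra h
    apply hne
    constructor <;> nlinarith [sq_nonneg (p (x₁, y₁)), sq_nonneg (q (x₁, y₁))]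
  set κ := (p (x₁, y₁) ^ 2 + q (x₁, y₁) ^ 2) / 2 with hκ
  have hκ0 : 0 < κ := by positivity
  obtain ⟨r, hr, hr1, hrκ⟩ : ∃ r, 0 < r ∧ r ≤ 1 ∧
      ∀ s ∈ Set.Icc x₁ (x₁ + r), κ ≤ p (s, y₁) ^ 2 + q (s, y₁) ^ 2 := by
    have hc : Continuous fun s => p (s, y₁) ^ 2 + q (s, y₁) ^ 2 := by fun_prop
    have := hc.continuousAt.eventually (lt_mem_nhds (show κ < p (x₁, y₁) ^ 2 + q (x₁, y₁) ^ 2 by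
      linarith))
    obtain ⟨r, hr, h⟩ := Metric.eventually_nhds_iff.1 this
    refine ⟨min (r / 2) 1, by positivity, min_le_right _ _, fun s hs => (h ?_).le⟩
    rw [Real.dist_eq, abs_lt]
    have := min_le_left (r / 2) 1
    constructor <;> linarith [hs.1, hs.2]
  obtain ⟨C, hC⟩ := ((hp.differentiable one_ne_zero) (x₀, y₀)).isBigO_sub.bound
  obtain ⟨C', hC'⟩ := ((hq.differentiable one_ne_zero) (x₀, y₀)).isBigO_sub.bound
  obtain ⟨δ₀, hδ₀, hball⟩ := Metric.eventually_nhds_iff.1 (hC.and hC')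
  set L := C ^ 2 + C' ^ 2 + 1
  have hL : 0 < L := by positivity
  have key : ∀ δ, 0 < δ → δ ≤ 1 → δ < δ₀ →
      2 * (Real.log κ - (1 + 1 / r) * (1 + M)) ≤ 2 * M + 2 * Real.log L + 3 * Real.log δ := by
    intro δ hδ hδ1 hδδ
    have hg : ContDiff ℝ 1 (logSq p q δ) := contDiff_logSq (n := 1) hp hq hδ
    have hgc := hg.continuous
    have hgp : IsPlanePeriodic (logSq p q δ) := fun x y => by
      simp only [logSq, (hpp x y).1, (hpp x y).2, (hqp x y).1, (hqp x y).2, and_self]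
    have h1 := cone_estimate hg hgp x₀ y₀ hδ hδ1
    have h2 := columnMean_lower_bound hg hgp (y₁ := y₁) (c := Real.log κ) hr hr1 (fun s hs => by
      unfold logSq
      apply Real.log_le_log hκ0
      nlinarith [hrκ s hs, sq_nonneg δ]) (x₀ + 1)
    have h3 : ∫ t in (-1 : ℝ)..1, logSq p q δ (x₀ + 1, y₀ + t) =
        2 * columnMean (logSq p q δ) (x₀ + 1) := by
      have hper := hgp.periodic_snd (x₀ + 1)
      have hcc : Continuous fun y => logSq p q δ (x₀ + 1, y) := by fun_prop
      rw [intervalIntegral.integral_comp_add_left (fun y => logSq p q δ (x₀ + 1, y)),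
        ← intervalIntegral.integral_add_adjacent_intervals (b := y₀)
        (hcc.intervalIntegrable _ _) (hcc.intervalIntegrable _ _)]
      have e1 := hper.intervalIntegral_add_eq y₀ 0
      have e2 := hper.intervalIntegral_add_eq (y₀ + -1) 0
      rw [neg_add_cancel_right] at e2
      rw [e1, e2, columnMean, zero_add]; ring
    have h4 : ∫ t in (-1 : ℝ)..1, logSq p q δ (x₀ + δ, y₀ + δ * t) ≤
        ∫ t in (-1 : ℝ)..1, (Real.log L + 2 * Real.log δ) := by
      apply intervalIntegral.integral_mono_on (by norm_num)
        (Continuous.intervalIntegrable (by fun_prop) _ _) intervalIntegrable_const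
      intro t ht
      have hnorm : ‖((x₀ + δ, y₀ + δ * t) : ℝ × ℝ) - (x₀, y₀)‖ = δ := by
        simp only [Prod.mk_sub_mk, add_sub_cancel_left, Prod.norm_mk, Real.norm_eq_abs, abs_mul,
          abs_of_pos hδ]
        apply max_eq_left
        exact mul_le_of_le_one_right hδ.le (abs_le.2 ht)
      obtain ⟨b1, b2⟩ := hball (y := (x₀ + δ, y₀ + δ * t)) (by rwa [dist_eq_norm, hnorm])
      rw [hnorm, hp0, sub_zero, Real.norm_eq_abs] at b1
      rw [hnorm, hq0, sub_zero, Real.norm_eq_abs] at b2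
      have b1' := sq_le_sq₀ (abs_nonneg _) ((abs_nonneg _).trans b1) |>.2 b1
      have b2' := sq_le_sq₀ (abs_nonneg _) ((abs_nonneg _).trans b2) |>.2 b2
      rw [sq_abs, mul_pow] at b1' b2'
      have : Real.log L + 2 * Real.log δ = Real.log (L * δ ^ 2) := by
        rw [Real.log_mul hL.ne' (by positivity), Real.log_pow]; norm_num
      rw [this]
      unfold logSq
      apply Real.log_le_log (logSq_arg_pos hδ _)
      simp only [L]
      nlinarith
    have h5 := hM δ hδ
    have h6 : (1 + 1 / r) * (1 + cellInt (gradSq (logSq p q δ))) ≤ (1 + 1 / r) * (1 + M) := by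
      gcongr
    rw [intervalIntegral.integral_const, smul_eq_mul] at h4
    rw [h3] at h1
    linarith
  have hlim : Filter.Tendsto (fun δ => 2 * M + 2 * Real.log L + 3 * Real.log δ)
      (nhdsWithin 0 (Set.Ioi 0)) Filter.atBot :=
    Filter.tendsto_atBot_add_const_left _ _
      (Real.tendsto_log_nhdsGT_zero.const_mul_atBot (by norm_num))
  have h1 := hlim.eventually (Filter.eventually_lt_atBot
    (2 * (Real.log κ - (1 + 1 / r) * (1 + M))))
  have h2 : ∀ᶠ δ in nhdsWithin (0 : ℝ) (Set.Ioi 0), δ ∈ Set.Ioo 0 (min 1 δ₀) :=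
    Ioo_mem_nhdsGT (by positivity)
  obtain ⟨δ, h3, h4⟩ := (h1.and h2).exists
  have := key δ h4.1 (h4.2.le.trans (min_le_left _ _)) (h4.2.trans_le (min_le_right _ _))
  linarith

end Vanishing

section Elliptic

lemma IsPlanePeriodic.exists_mem_cell {α : Type*} {f : ℝ × ℝ → α} (hp : IsPlanePeriodic f)
    (z : ℝ × ℝ) : ∃ w ∈ Set.Icc (0 : ℝ) 1 ×ˢ Set.Icc (0 : ℝ) 1, f z = f w := by
  obtain ⟨x, y⟩ := z
  obtain ⟨x', hx', h1⟩ := (hp.periodic_fst y).exists_mem_Ico₀ one_pos x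
  obtain ⟨y', hy', h2⟩ := (hp.periodic_snd x').exists_mem_Ico₀ one_pos y
  exact ⟨(x', y'), ⟨⟨hx'.1, hx'.2.le⟩, ⟨hy'.1, hy'.2.le⟩⟩, h1.trans h2⟩

lemma IsPlanePeriodic.exists_bound {f : ℝ × ℝ → ℝ} (hp : IsPlanePeriodic f) (hf : Continuous f) :
    ∃ C > 0, ∀ z, |f z| ≤ C := by
  obtain ⟨C, hC⟩ := (isCompact_Icc.prod isCompact_Icc :
    IsCompact (Set.Icc (0 : ℝ) 1 ×ˢ Set.Icc (0 : ℝ) 1)).exists_bound_of_continuousOn hf.continuousOn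
  refine ⟨max C 1, by positivity, fun z => ?_⟩
  obtain ⟨w, hw, h⟩ := hp.exists_mem_cell z
  rw [h]
  exact (hC w hw).trans (le_max_left _ _)

lemma IsPlanePeriodic.comp₂ {α β γ : Type*} {f : ℝ × ℝ → α} {g : ℝ × ℝ → β}
    (hf : IsPlanePeriodic f) (hg : IsPlanePeriodic g) (F : α → β → γ) :
    IsPlanePeriodic fun z => F (f z) (g z) := fun x y => by
  simp only [(hf x y).1, (hf x y).2, (hg x y).1, (hg x y).2, and_self]

lemma jacobian_lower_bound {a b c px py qy t : ℝ} (ha : 0 < a) (hd : 0 < a * c - b ^ 2)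
    (h : a * px + 2 * b * py + c * qy = t) :
    (a * c - b ^ 2) / (2 * (a + c) ^ 2) * (px ^ 2 + py ^ 2 + (py ^ 2 + qy ^ 2)) ≤
      -(px * qy - py * py) + t ^ 2 / (a * c - b ^ 2) := by
  have hc : 0 < c := by
    by_contra hc
    nlinarith [sq_nonneg b, mul_nonneg ha.le (neg_nonneg.2 (not_lt.1 hc))]
  set d := a * c - b ^ 2 with hdd
  set s := a + c with hs
  have hs0 : 0 < s := by positivity
  have e1 : s * (a * px ^ 2 + 2 * b * px * py + c * py ^ 2) =
      d * (px ^ 2 + py ^ 2) + (a * px + b * py) ^ 2 + (b * px + c * py) ^ 2 := by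
    rw [hs, hdd]; ring
  have e2 : s * (a * py ^ 2 + 2 * b * py * qy + c * qy ^ 2) =
      d * (py ^ 2 + qy ^ 2) + (a * py + b * qy) ^ 2 + (b * py + c * qy) ^ 2 := by
    rw [hs, hdd]; ring
  have e3 : -(px * qy - py * py) * s ^ 2 =
      s * (a * px ^ 2 + 2 * b * px * py + c * py ^ 2) +
      s * (a * py ^ 2 + 2 * b * py * qy + c * qy ^ 2) - s * t * (px + qy) := by
    rw [← h, hs]; ring
  have y1 : s * t * px ≤ d / 2 * px ^ 2 + s ^ 2 * t ^ 2 / (2 * d) := by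
    have : d / 2 * px ^ 2 + s ^ 2 * t ^ 2 / (2 * d) - s * t * px =
      (d * px - s * t) ^ 2 / (2 * d) := by field_simp; ring
    have h2 : 0 ≤ (d * px - s * t) ^ 2 / (2 * d) := by positivity
    linarith
  have y2 : s * t * qy ≤ d / 2 * qy ^ 2 + s ^ 2 * t ^ 2 / (2 * d) := by
    have : d / 2 * qy ^ 2 + s ^ 2 * t ^ 2 / (2 * d) - s * t * qy =
      (d * qy - s * t) ^ 2 / (2 * d) := by field_simp; ring
    have h2 : 0 ≤ (d * qy - s * t) ^ 2 / (2 * d) := by positivity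
    linarith
  have e4 : d / 2 * (px ^ 2 + py ^ 2 + (py ^ 2 + qy ^ 2)) ≤
      (-(px * qy - py * py) + t ^ 2 / d) * s ^ 2 := by
    have : t ^ 2 / d * s ^ 2 = s ^ 2 * t ^ 2 / (2 * d) + s ^ 2 * t ^ 2 / (2 * d) := by
      field_simp; ring
    rw [add_mul, e3, this, e1, e2]
    nlinarith [sq_nonneg (a * px + b * py), sq_nonneg (b * px + c * py),
      sq_nonneg (a * py + b * qy), sq_nonneg (b * py + c * qy), mul_nonneg hd.le (sq_nonneg py)]
  rw [← div_le_iff₀ (by positivity)] at e4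
  calc _ = d / 2 * (px ^ 2 + py ^ 2 + (py ^ 2 + qy ^ 2)) / s ^ 2 := by field_simp
    _ ≤ _ := e4

variable {p q a b c α β : ℝ × ℝ → ℝ}

/-- A curl-free periodic solution of a second order elliptic equation in nondivergence form with
lower order terms vanishes identically as soon as it has a zero, provided that its Jacobian has
vanishing weighted means. -/
theorem eq_zero_of_elliptic (hp : ContDiff ℝ 1 p) (hq : ContDiff ℝ 1 q)
    (hpp : IsPlanePeriodic p) (hqp : IsPlanePeriodic q)
    (ha : Continuous a) (hb : Continuous b) (hc : Continuous c)
    (hα : Continuous α) (hβ : Continuous β)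
    (hap : IsPlanePeriodic a) (hbp : IsPlanePeriodic b) (hcp : IsPlanePeriodic c)
    (hαp : IsPlanePeriodic α) (hβp : IsPlanePeriodic β)
    (ha0 : ∀ z, 0 < a z) (hd0 : ∀ z, 0 < a z * c z - b z ^ 2)
    (hcurl : ∀ z, dx q z = dy p z)
    (heq : ∀ z, a z * dx p z + 2 * b z * dy p z + c z * dy q z + (α z * p z + β z * q z) = 0)
    (hJ : ∀ ε > 0, cellInt (fun z => (dx p z * dy q z - dy p z * dx q z) /
      (p z ^ 2 + q z ^ 2 + ε ^ 2)) = 0)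
    {z₀ : ℝ × ℝ} (hp0 : p z₀ = 0) (hq0 : q z₀ = 0) (z₁ : ℝ × ℝ) : p z₁ = 0 ∧ q z₁ = 0 := by
  have hpc := hp.continuous
  have hqc := hq.continuous
  have hpx := continuous_dx hp
  have hpy := continuous_dy hp
  have hqx := continuous_dx hq
  have hqy := continuous_dy hq
  have hgp := continuous_gradSq hp
  have hgq := continuous_gradSq hq
  set d : ℝ × ℝ → ℝ := fun z => a z * c z - b z ^ 2
  have hdc : Continuous d := by fun_prop
  have hdp : IsPlanePeriodic d := (hap.comp₂ hcp (· * ·)).comp₂ hbp fun u v => u - v ^ 2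
  obtain ⟨K, hK, hKb⟩ := (hdp.comp₂ (hap.comp₂ hcp (· + ·)) fun u v => 2 * v ^ 2 / u).exists_bound
    (Continuous.div (by fun_prop) (by fun_prop) fun z => (hd0 z).ne')
  obtain ⟨N, hN, hNb⟩ := (hdp.comp₂ (hαp.comp₂ hβp fun u v => u ^ 2 + v ^ 2)
    fun u v => v / u).exists_bound
    (Continuous.div (by fun_prop) (by fun_prop) fun z => (hd0 z).ne')
  have hpt : ∀ z, gradSq p z + gradSq q z ≤
      K * (-(dx p z * dy q z - dy p z * dx q z) + N * (p z ^ 2 + q z ^ 2)) := by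
    intro z
    have hd := hd0 z
    have hcz : 0 < c z := by
      by_contra h
      nlinarith [sq_nonneg (b z), mul_nonneg (ha0 z).le (neg_nonneg.2 (not_lt.1 h))]
    have haz := ha0 z
    have h1 := jacobian_lower_bound (t := -(α z * p z + β z * q z)) (ha0 z) (hd0 z)
      (by linarith [heq z] : a z * dx p z + 2 * b z * dy p z + c z * dy q z = _)
    have h2 : (-(α z * p z + β z * q z)) ^ 2 / (a z * c z - b z ^ 2) ≤ N * (p z ^ 2 + q z ^ 2) := by
      calc _ ≤ (α z ^ 2 + β z ^ 2) * (p z ^ 2 + q z ^ 2) / (a z * c z - b z ^ 2) := by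
            gcongr
            nlinarith [sq_nonneg (α z * q z - β z * p z)]
        _ = (α z ^ 2 + β z ^ 2) / d z * (p z ^ 2 + q z ^ 2) := by simp only [d]; ring
        _ ≤ _ := by
            gcongr
            exact (le_abs_self _).trans (hNb z)
    have h3 : 2 * (a z + c z) ^ 2 / (a z * c z - b z ^ 2) ≤ K := (le_abs_self _).trans (hKb z)
    set G := gradSq p z + gradSq q z with hG
    have hG' : dx p z ^ 2 + dy p z ^ 2 + (dy p z ^ 2 + dy q z ^ 2) = G := by
      rw [hG, gradSq, gradSq, hcurl]
    have hG0 : 0 ≤ G := add_nonneg (gradSq_nonneg _ _) (gradSq_nonneg _ _)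
    rw [hG'] at h1
    rw [hcurl]
    have h4 : (a z * c z - b z ^ 2) / (2 * (a z + c z) ^ 2) * G ≤
      -(dx p z * dy q z - dy p z * dy p z) + N * (p z ^ 2 + q z ^ 2) := h1.trans (by linarith)
    have h5 : 0 ≤ (a z * c z - b z ^ 2) / (2 * (a z + c z) ^ 2) * G := by positivity
    calc G = 2 * (a z + c z) ^ 2 / (a z * c z - b z ^ 2) *
          ((a z * c z - b z ^ 2) / (2 * (a z + c z) ^ 2) * G) := by field_simp
      _ ≤ _ := mul_le_mul h3 h4 h5 hK.le
  refine eq_zero_of_logSq_energy_bound hp hq hpp hqp (M := 4 * (K * N)) (fun ε hε => ?_)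
    hp0 hq0 z₁
  have hR := fun z => logSq_arg_pos (p := p) (q := q) hε z
  have hR' := fun z => (hR z).ne'
  have hcont : Continuous fun z => (-4 * K) * ((dx p z * dy q z - dy p z * dx q z) /
      (p z ^ 2 + q z ^ 2 + ε ^ 2)) :=
    continuous_const.mul (Continuous.div (by fun_prop) (by fun_prop) hR')
  calc cellInt (gradSq (logSq p q ε))
      ≤ cellInt fun z => (-4 * K) * ((dx p z * dy q z - dy p z * dx q z) /
          (p z ^ 2 + q z ^ 2 + ε ^ 2)) + 4 * (K * N) := by
        apply cellInt_mono (continuous_gradSq (contDiff_logSq (n := 1) hp hq hε))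
        · exact hcont.add continuous_const
        · intro z
          refine (gradSq_logSq_le hp hq hε z).trans ?_
          have h1 : (gradSq p z + gradSq q z) / (p z ^ 2 + q z ^ 2 + ε ^ 2) ≤
              K * (-(dx p z * dy q z - dy p z * dx q z) + N * (p z ^ 2 + q z ^ 2 + ε ^ 2)) /
              (p z ^ 2 + q z ^ 2 + ε ^ 2) := by
            apply div_le_div_of_nonneg_right _ (hR z).le
            refine (hpt z).trans ?_
            exact mul_le_mul_of_nonneg_left (by nlinarith [mul_nonneg hN.le (sq_nonneg ε)]) hK.le
          have h2 : K * (-(dx p z * dy q z - dy p z * dx q z) + N * (p z ^ 2 + q z ^ 2 + ε ^ 2)) /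
              (p z ^ 2 + q z ^ 2 + ε ^ 2) = -K * ((dx p z * dy q z - dy p z * dx q z) /
          (p z ^ 2 + q z ^ 2 + ε ^ 2)) + K * N := by
            have := hR' z
            field_simp
          linarith
    _ = 4 * (K * N) := by
        rw [cellInt_add hcont continuous_const, cellInt_const_mul, hJ ε hε, cellInt_const]
        ring

end Elliptic

section Unfolding

lemma integral_mul_periodic {f g : ℝ → ℝ} (hf : Continuous f) (hg : Continuous g)
    (hper : Function.Periodic f 1) (hsupp : ∀ x, x ∉ Set.Icc (-1 : ℝ) 1 → g x = 0) :
    ∫ x, g x * f x = ∫ x in (0 : ℝ)..1, (g (x - 1) + g x) * f x := by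
  have h1 : ∫ x, g x * f x = ∫ x in Set.Icc (-1 : ℝ) 1, g x * f x :=
    (setIntegral_eq_integral_of_forall_compl_eq_zero fun x hx => by simp [hsupp x hx]).symm
  rw [h1, integral_Icc_eq_integral_Ioc, ← intervalIntegral.integral_of_le (by norm_num),
    ← intervalIntegral.integral_add_adjacent_intervals (b := 0)
      (Continuous.intervalIntegrable (by fun_prop) _ _)
      (Continuous.intervalIntegrable (by fun_prop) _ _)]
  have h2 : ∫ x in (-1 : ℝ)..0, g x * f x = ∫ x in (0 : ℝ)..1, g (x - 1) * f x := by
    have := intervalIntegral.integral_comp_sub_right (a := 0) (b := 1) (fun x => g x * f x) 1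
    norm_num at this
    rw [← this]
    simp only [hper.sub_eq]
  rw [h2, ← intervalIntegral.integral_add]
  · simp only [add_mul]
  all_goals exact Continuous.intervalIntegrable (by fun_prop) _ _

lemma hasCompactSupport_mul_mul {f : ℝ × ℝ → ℝ} {g₁ g₂ : ℝ → ℝ}
    (hs₁ : ∀ x, x ∉ Set.Icc (-1 : ℝ) 1 → g₁ x = 0) (hs₂ : ∀ x, x ∉ Set.Icc (-1 : ℝ) 1 → g₂ x = 0) :
    HasCompactSupport fun z : ℝ × ℝ => g₁ z.1 * g₂ z.2 * f z := by
  apply HasCompactSupport.intro (K := Set.Icc (-1 : ℝ) 1 ×ˢ Set.Icc (-1 : ℝ) 1)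
    (isCompact_Icc.prod isCompact_Icc)
  intro z hz
  rw [Set.mem_prod, not_and_or] at hz
  rcases hz with hz | hz
  · simp [hs₁ _ hz]
  · simp [hs₂ _ hz]

lemma integrable_mul_mul {f : ℝ × ℝ → ℝ} {g₁ g₂ : ℝ → ℝ}
    (hf : Continuous f) (hg₁ : Continuous g₁) (hg₂ : Continuous g₂)
    (hs₁ : ∀ x, x ∉ Set.Icc (-1 : ℝ) 1 → g₁ x = 0) (hs₂ : ∀ x, x ∉ Set.Icc (-1 : ℝ) 1 → g₂ x = 0) :
    Integrable fun z : ℝ × ℝ => g₁ z.1 * g₂ z.2 * f z :=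
  Continuous.integrable_of_hasCompactSupport (by fun_prop) (hasCompactSupport_mul_mul hs₁ hs₂)

lemma integral_mul_planePeriodic {f : ℝ × ℝ → ℝ} {g₁ g₂ : ℝ → ℝ} (hf : Continuous f)
    (hp : IsPlanePeriodic f) (hg₁ : Continuous g₁) (hg₂ : Continuous g₂)
    (hs₁ : ∀ x, x ∉ Set.Icc (-1 : ℝ) 1 → g₁ x = 0) (hs₂ : ∀ x, x ∉ Set.Icc (-1 : ℝ) 1 → g₂ x = 0) :
    ∫ z : ℝ × ℝ, g₁ z.1 * g₂ z.2 * f z =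
      cellInt fun z => (g₁ (z.1 - 1) + g₁ z.1) * (g₂ (z.2 - 1) + g₂ z.2) * f z := by
  rw [cellInt_eq_iterated (by fun_prop)]
  have h := integral_prod (μ := volume) (ν := volume) _
    (integrable_mul_mul hf hg₁ hg₂ hs₁ hs₂)
  refine h.trans ?_
  have h1 : ∀ x : ℝ, ∫ y, g₁ x * g₂ y * f (x, y) =
      g₁ x * ∫ y in (0 : ℝ)..1, (g₂ (y - 1) + g₂ y) * f (x, y) := fun x => by
    rw [← integral_mul_periodic (by fun_prop) hg₂ (hp.periodic_snd x) hs₂, ← integral_const_mul]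
    simp only [mul_assoc]
  simp only [h1]
  rw [integral_mul_periodic _ hg₁ _ hs₁]
  · refine intervalIntegral.integral_congr fun x _ => ?_
    simp only [mul_assoc, intervalIntegral.integral_const_mul]
  · exact intervalIntegral.continuous_parametric_intervalIntegral_of_continuous' (by
      unfold Function.uncurry; fun_prop) _ _
  · intro x
    simp only [(hp _ _).1]

/-- A smooth function on the line whose integer translates sum to one. -/
noncomputable def unitBump (x : ℝ) : ℝ := Real.smoothTransition (x + 1) - Real.smoothTransition x

lemma contDiff_unitBump {n : ℕ∞} : ContDiff ℝ n unitBump :=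
  (Real.smoothTransition.contDiff.comp (contDiff_id.add contDiff_const)).sub
    Real.smoothTransition.contDiff

lemma unitBump_eq_zero {x : ℝ} (hx : x ∉ Set.Icc (-1 : ℝ) 1) : unitBump x = 0 := by
  rw [Set.mem_Icc, not_and_or, not_le, not_le] at hx
  unfold unitBump
  rcases hx with hx | hx
  · rw [Real.smoothTransition.zero_of_nonpos (by linarith),
      Real.smoothTransition.zero_of_nonpos (by linarith), sub_zero]
  · rw [Real.smoothTransition.one_of_one_le (by linarith),
      Real.smoothTransition.one_of_one_le (by linarith), sub_self]

lemma unitBump_add {x : ℝ} (hx : x ∈ Set.Icc (0 : ℝ) 1) : unitBump (x - 1) + unitBump x = 1 := by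
  unfold unitBump
  rw [Real.smoothTransition.one_of_one_le (x := x + 1) (by linarith [hx.1]),
      Real.smoothTransition.zero_of_nonpos (x := x - 1) (by linarith [hx.2])]
  simp

lemma deriv_smoothTransition_of_nonpos {x : ℝ} (hx : x ≤ 0) :
    deriv Real.smoothTransition x = 0 := by
  apply IsLocalMin.deriv_eq_zero
  refine Filter.Eventually.of_forall fun y => ?_
  rw [Real.smoothTransition.zero_of_nonpos hx]
  exact Real.smoothTransition.nonneg y

lemma deriv_smoothTransition_of_one_le {x : ℝ} (hx : 1 ≤ x) :
    deriv Real.smoothTransition x = 0 := by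
  apply IsLocalMax.deriv_eq_zero
  refine Filter.Eventually.of_forall fun y => ?_
  rw [Real.smoothTransition.one_of_one_le hx]
  exact Real.smoothTransition.le_one y

lemma deriv_unitBump (x : ℝ) : deriv unitBump x =
    deriv Real.smoothTransition (x + 1) - deriv Real.smoothTransition x := by
  have h : Differentiable ℝ Real.smoothTransition :=
    Real.smoothTransition.contDiff.differentiable (n := 1) one_ne_zero
  have h1 := (h (x + 1)).hasDerivAt.comp_add_const x 1
  exact (h1.sub (h x).hasDerivAt).deriv

lemma deriv_unitBump_eq_zero {x : ℝ} (hx : x ∉ Set.Icc (-1 : ℝ) 1) : deriv unitBump x = 0 := by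
  rw [deriv_unitBump]
  rw [Set.mem_Icc, not_and_or, not_le, not_le] at hx
  rcases hx with hx | hx
  · rw [deriv_smoothTransition_of_nonpos (by linarith),
      deriv_smoothTransition_of_nonpos (by linarith), sub_zero]
  · rw [deriv_smoothTransition_of_one_le (by linarith),
      deriv_smoothTransition_of_one_le (by linarith), sub_self]

lemma deriv_unitBump_add {x : ℝ} (hx : x ∈ Set.Icc (0 : ℝ) 1) :
    deriv unitBump (x - 1) + deriv unitBump x = 0 := by
  rw [deriv_unitBump, deriv_unitBump,
    deriv_smoothTransition_of_one_le (x := x + 1) (by linarith [hx.1]),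
    deriv_smoothTransition_of_nonpos (x := x - 1) (by linarith [hx.2])]
  simp

/-- The field `(F₁, F₂)` is divergence-free in the sense of distributions. -/
def WeakDivFree (F₁ F₂ : ℝ × ℝ → ℝ) : Prop :=
  ∀ φ : ℝ × ℝ → ℝ, ContDiff ℝ (⊤ : ℕ∞) φ → HasCompactSupport φ →
    ∫ z, (F₁ z * dx φ z + F₂ z * dy φ z) = 0

/-- Divergence-free periodic fields may be tested with periodic functions on the unit cell. -/
lemma WeakDivFree.cellInt_eq_zero {F₁ F₂ : ℝ × ℝ → ℝ} (h : WeakDivFree F₁ F₂)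
    (h₁ : Continuous F₁) (h₂ : Continuous F₂) (hp₁ : IsPlanePeriodic F₁) (hp₂ : IsPlanePeriodic F₂)
    {ψ : ℝ × ℝ → ℝ} (hψ : ContDiff ℝ (⊤ : ℕ∞) ψ) (hψp : IsPlanePeriodic ψ) :
    cellInt (fun z => F₁ z * dx ψ z + F₂ z * dy ψ z) = 0 := by
  have hψ1 : ContDiff ℝ 1 ψ := hψ.of_le (by exact_mod_cast le_top)
  have hb : ContDiff ℝ (⊤ : ℕ∞) unitBump := contDiff_unitBump
  have hb1 : ContDiff ℝ 1 unitBump := contDiff_unitBump (n := 1)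
  have hbc : Continuous unitBump := hb.continuous
  have hbd : Continuous (deriv unitBump) := hb1.continuous_deriv le_rfl
  have hder := fun x => ((hb1.differentiable one_ne_zero) x).hasDerivAt
  have hψx := continuous_dx hψ1
  have hψy := continuous_dy hψ1
  have hψc := hψ.continuous
  set φ : ℝ × ℝ → ℝ := fun z => unitBump z.1 * unitBump z.2 * ψ z
  have hφ : ContDiff ℝ (⊤ : ℕ∞) φ :=
    ((hb.comp contDiff_fst).mul (hb.comp contDiff_snd)).mul hψ
  have hφd := hφ.differentiable (by simp)
  have hdx : ∀ z, dx φ z = deriv unitBump z.1 * unitBump z.2 * ψ z +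
      unitBump z.1 * unitBump z.2 * dx ψ z := fun z => by
    apply dx_eq_of_hasDerivAt (hφd z)
    exact ((hder z.1).mul_const (unitBump z.2)).fun_mul (hasDerivAt_dx hψ1 z.1 z.2)
  have hdy : ∀ z, dy φ z = unitBump z.1 * deriv unitBump z.2 * ψ z +
      unitBump z.1 * unitBump z.2 * dy ψ z := fun z => by
    apply dy_eq_of_hasDerivAt (hφd z)
    exact ((hder z.2).const_mul (unitBump z.1)).fun_mul (hasDerivAt_dy hψ1 z.1 z.2)
  have h0 := h φ hφ (hasCompactSupport_mul_mul (fun x => unitBump_eq_zero)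
    fun x => unitBump_eq_zero)
  have hsplit : ∀ z, F₁ z * dx φ z + F₂ z * dy φ z =
      deriv unitBump z.1 * unitBump z.2 * (F₁ z * ψ z) +
      unitBump z.1 * deriv unitBump z.2 * (F₂ z * ψ z) +
      unitBump z.1 * unitBump z.2 * (F₁ z * dx ψ z + F₂ z * dy ψ z) := fun z => by
    rw [hdx, hdy]; ring
  simp only [hsplit] at h0
  have p1 := hp₁.comp₂ hψp (· * ·)
  have p2 := hp₂.comp₂ hψp (· * ·)
  have p3 := (hp₁.comp₂ (isPlanePeriodic_dx hψp) (· * ·)).comp₂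
    (hp₂.comp₂ (isPlanePeriodic_dy hψp) (· * ·)) (· + ·)
  have z0 := fun x => @unitBump_eq_zero x
  have z1 := fun x => @deriv_unitBump_eq_zero x
  rw [integral_add, integral_add, integral_mul_planePeriodic (by fun_prop) p1 hbd hbc z1 z0,
    integral_mul_planePeriodic (by fun_prop) p2 hbc hbd z0 z1,
    integral_mul_planePeriodic (by fun_prop) p3 hbc hbc z0 z0] at h0
  · have hQ : MeasurableSet (Set.Ioc (0 : ℝ) 1 ×ˢ Set.Ioc (0 : ℝ) 1) :=
      measurableSet_Ioc.prod measurableSet_Ioc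
    have e1 : cellInt (fun z : ℝ × ℝ => (deriv unitBump (z.1 - 1) + deriv unitBump z.1) *
        (unitBump (z.2 - 1) + unitBump z.2) * (F₁ z * ψ z)) = 0 :=
      setIntegral_eq_zero_of_forall_eq_zero fun z hz => by
        rw [deriv_unitBump_add (Set.Ioc_subset_Icc_self hz.1)]; simp
    have e2 : cellInt (fun z : ℝ × ℝ => (unitBump (z.1 - 1) + unitBump z.1) *
        (deriv unitBump (z.2 - 1) + deriv unitBump z.2) * (F₂ z * ψ z)) = 0 :=
      setIntegral_eq_zero_of_forall_eq_zero fun z hz => by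
        rw [deriv_unitBump_add (Set.Ioc_subset_Icc_self hz.2)]; simp
    rw [e1, e2, zero_add, zero_add] at h0
    rw [← h0]
    refine setIntegral_congr_fun hQ fun z hz => ?_
    simp only [unitBump_add (Set.Ioc_subset_Icc_self hz.1),
      unitBump_add (Set.Ioc_subset_Icc_self hz.2), one_mul]
  · exact integrable_mul_mul (by fun_prop) hbd hbc z1 z0
  · exact integrable_mul_mul (by fun_prop) hbc hbd z0 z1
  · exact (integrable_mul_mul (by fun_prop) hbd hbc z1 z0).add
      (integrable_mul_mul (by fun_prop) hbc hbd z0 z1)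
  · exact integrable_mul_mul (by fun_prop) hbc hbc z0 z0

end Unfolding

section TorusFourier

attribute [local instance] instMeasureSpaceUnitAddCircle
  instIsProbabilityMeasureUnitAddCircleVolume

section Torus

/-- The projection of the plane onto the two-dimensional torus. -/
noncomputable def planeToTorus (z : ℝ × ℝ) : UnitAddTorus (Fin 2) :=
  ![(z.1 : UnitAddCircle), (z.2 : UnitAddCircle)]

lemma isOpenQuotientMap_planeToTorus : IsOpenQuotientMap planeToTorus := by
  have h1 : IsOpenQuotientMap (Pi.map fun (_ : Fin 2) (x : ℝ) => (x : UnitAddCircle)) :=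
    IsOpenQuotientMap.piMap fun _ => QuotientAddGroup.isOpenQuotientMap_mk
  have h2 := h1.comp (Homeomorph.finTwoArrow (X := ℝ)).symm.isOpenQuotientMap
  convert h2 using 1
  ext z i
  fin_cases i <;> rfl

/-- A function on the plane, restricted to the unit cell and viewed on the torus. -/
noncomputable def torusLift {α : Type*} (f : ℝ × ℝ → α) (t : UnitAddTorus (Fin 2)) : α :=
  f (AddCircle.equivIoc 1 0 (t 0), AddCircle.equivIoc 1 0 (t 1))

lemma torusLift_planeToTorus {α : Type*} {f : ℝ × ℝ → α} (hf : IsPlanePeriodic f) (z : ℝ × ℝ) :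
    torusLift f (planeToTorus z) = f z := by
  have h1 := fun y => (hf.periodic_fst y).sub_zsmul_eq (x := z.1) (toIocDiv one_pos 0 z.1)
  have h2 := fun x => (hf.periodic_snd x).sub_zsmul_eq (x := z.2) (toIocDiv one_pos 0 z.2)
  exact (h1 _).trans (h2 _)

lemma continuous_torusLift {α : Type*} [TopologicalSpace α] {f : ℝ × ℝ → α}
    (hc : Continuous f) (hf : IsPlanePeriodic f) : Continuous (torusLift f) := by
  rw [isOpenQuotientMap_planeToTorus.isQuotientMap.continuous_iff]
  convert hc
  ext z
  exact torusLift_planeToTorus hf z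

variable {E : Type*} [NormedAddCommGroup E] [NormedSpace ℝ E]

lemma integral_torus_eq_cellInt (F : UnitAddTorus (Fin 2) → E) :
    ∫ t, F t = cellInt fun z => F (planeToTorus z) := by
  rw [UnitAddTorus.integral_preimage F 0, cellInt,
    ← (volume_preserving_finTwoArrow ℝ).setIntegral_preimage_emb
      MeasurableEquiv.finTwoArrow.measurableEmbedding]
  have h : {x : Fin 2 → ℝ | ∀ i, x i ∈ Set.Ioc ((0 : Fin 2 → ℝ) i) ((0 : Fin 2 → ℝ) i + 1)} =
      MeasurableEquiv.finTwoArrow ⁻¹' Set.Ioc (0 : ℝ) 1 ×ˢ Set.Ioc (0 : ℝ) 1 := by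
    ext x
    simp [Fin.forall_fin_two, MeasurableEquiv.finTwoArrow, MeasurableEquiv.piFinTwo]
  rw [h]
  congr 1
  ext x
  congr 1
  ext i
  fin_cases i <;> rfl

/-- The exponential `exp (2πi (n₀ x + n₁ y))` on the plane. -/
noncomputable def planeChar (n : Fin 2 → ℤ) (z : ℝ × ℝ) : ℂ :=
  Complex.exp ((2 * Real.pi * (n 0 * z.1 + n 1 * z.2) : ℝ) * Complex.I)

lemma mFourier_planeToTorus (n : Fin 2 → ℤ) (z : ℝ × ℝ) :
    UnitAddTorus.mFourier n (planeToTorus z) = planeChar n z := by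
  simp only [UnitAddTorus.mFourier, ContinuousMap.coe_mk, Fin.prod_univ_two, planeToTorus,
    Matrix.cons_val_zero, Matrix.cons_val_one, fourier_coe_apply, planeChar, ← Complex.exp_add]
  congr 1
  push_cast
  ring

lemma planeChar_add (n : Fin 2 → ℤ) (z w : ℝ × ℝ) :
    planeChar n (z + w) = planeChar n z * planeChar n w := by
  simp only [planeChar, ← Complex.exp_add]
  congr 1
  push_cast [Prod.fst_add, Prod.snd_add]
  ring

lemma isPlanePeriodic_planeChar (n : Fin 2 → ℤ) : IsPlanePeriodic (planeChar n) := by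
  intro x y
  simp only [← mFourier_planeToTorus, planeToTorus]
  simp

lemma contDiff_planeChar (n : Fin 2 → ℤ) {N : WithTop ℕ∞} : ContDiff ℝ N (planeChar n) := by
  have h : ContDiff ℝ N fun z : ℝ × ℝ => 2 * Real.pi * (n 0 * z.1 + n 1 * z.2) := by fun_prop
  exact ((Complex.ofRealCLM.contDiff.comp h).mul contDiff_const).cexp

/-- Fourier coefficients of a function on the plane, computed on the unit cell. -/
noncomputable def cellCoeff (f : ℝ × ℝ → ℝ) (n : Fin 2 → ℤ) : ℂ :=
  cellInt fun z => planeChar (-n) z * (f z : ℂ)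

/-- The continuous function on the torus associated with a periodic function on the plane. -/
noncomputable def cellMap {f : ℝ × ℝ → ℝ} (hc : Continuous f) (hf : IsPlanePeriodic f) :
    C(UnitAddTorus (Fin 2), ℂ) :=
  ⟨fun t => Complex.ofReal (torusLift f t), by have := continuous_torusLift hc hf; fun_prop⟩

variable {f g : ℝ × ℝ → ℝ}

lemma mFourierCoeff_cellMap (hc : Continuous f) (hf : IsPlanePeriodic f) (n : Fin 2 → ℤ) :
    UnitAddTorus.mFourierCoeff (cellMap hc hf) n = cellCoeff f n := by
  rw [UnitAddTorus.mFourierCoeff, integral_torus_eq_cellInt, cellCoeff]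
  simp only [mFourier_planeToTorus, cellMap, ContinuousMap.coe_mk, torusLift_planeToTorus hf,
    smul_eq_mul]

/-- The **Parseval identity** for periodic functions on the plane. -/
lemma hasSum_cellCoeff_mul (hc : Continuous f) (hf : IsPlanePeriodic f) (hcg : Continuous g)
    (hg : IsPlanePeriodic g) :
    HasSum (fun n => starRingEnd ℂ (cellCoeff f n) * cellCoeff g n)
      (cellInt fun z => f z * g z : ℝ) := by
  have h := UnitAddTorus.hasSum_prod_mFourierCoeff
    (ContinuousMap.toLp 2 volume ℂ (cellMap hc hf)) (ContinuousMap.toLp 2 volume ℂ (cellMap hcg hg))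
  simp only [UnitAddTorus.mFourierCoeff_toLp, mFourierCoeff_cellMap] at h
  convert h using 1
  have h2 : ∫ t, starRingEnd ℂ (cellMap hc hf t) * cellMap hcg hg t =
      (cellInt fun z => f z * g z : ℝ) := by
    rw [integral_torus_eq_cellInt, cellInt, cellInt, ← integral_complex_ofReal]
    simp only [cellMap, ContinuousMap.coe_mk, torusLift_planeToTorus hf,
      torusLift_planeToTorus hg, Complex.conj_ofReal, Complex.ofReal_mul]
  rw [← h2]
  apply integral_congr_ae
  filter_upwards [(cellMap hc hf).coeFn_toLp (p := 2) (𝕜 := ℂ) volume,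
    (cellMap hcg hg).coeFn_toLp (p := 2) (𝕜 := ℂ) volume] with t h1 h2
  rw [h1, h2]

lemma hasSum_cellCoeff_sq (hc : Continuous f) (hf : IsPlanePeriodic f) :
    HasSum (fun n => ‖cellCoeff f n‖ ^ 2) (cellInt fun z => f z ^ 2) := by
  have h := hasSum_cellCoeff_mul hc hf hc hf
  simp only [← Complex.normSq_eq_conj_mul_self, Complex.normSq_eq_norm_sq, ← pow_two] at h
  exact_mod_cast h

/-- Fourier inversion for periodic functions on the plane. -/
lemma hasSum_cellCoeff_planeChar (hc : Continuous f) (hf : IsPlanePeriodic f)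
    (h : Summable fun n => ‖cellCoeff f n‖) (z : ℝ × ℝ) :
    HasSum (fun n => cellCoeff f n * planeChar n z) (f z : ℂ) := by
  have h' : Summable (UnitAddTorus.mFourierCoeff (cellMap hc hf)) := by
    simp only [funext (mFourierCoeff_cellMap hc hf)]
    exact h.of_norm
  have := UnitAddTorus.hasSum_mFourier_series_apply_of_summable h' (planeToTorus z)
  simp only [mFourierCoeff_cellMap, mFourier_planeToTorus, smul_eq_mul] at this
  convert this
  simp [cellMap, torusLift_planeToTorus hf]

end Torus

end TorusFourier

section Hodge

variable {f g F₁ F₂ P₁ P₂ u : ℝ × ℝ → ℝ}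

/-- Divergence-free fields, in terms of Fourier coefficients. -/
def FourierDivFree (F₁ F₂ : ℝ × ℝ → ℝ) : Prop :=
  ∀ n : Fin 2 → ℤ, (n 0 : ℂ) * cellCoeff F₁ n + (n 1 : ℂ) * cellCoeff F₂ n = 0

lemma cellCoeff_zero (f : ℝ × ℝ → ℝ) : cellCoeff f 0 = (cellInt f : ℝ) := by
  simp only [cellCoeff, planeChar, cellInt]
  rw [← integral_complex_ofReal]
  simp

/-- Divergence-free fields are orthogonal to curl-free fields, up to their means. -/
lemma FourierDivFree.cellInt_inner (hF : FourierDivFree F₁ F₂) (hP : FourierDivFree P₂ (-P₁))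
    (cF₁ : Continuous F₁) (cF₂ : Continuous F₂) (cP₁ : Continuous P₁) (cP₂ : Continuous P₂)
    (pF₁ : IsPlanePeriodic F₁) (pF₂ : IsPlanePeriodic F₂)
    (pP₁ : IsPlanePeriodic P₁) (pP₂ : IsPlanePeriodic P₂) :
    cellInt (fun z => F₁ z * P₁ z + F₂ z * P₂ z) =
      cellInt F₁ * cellInt P₁ + cellInt F₂ * cellInt P₂ := by
  have h := (hasSum_cellCoeff_mul cF₁ pF₁ cP₁ pP₁).add (hasSum_cellCoeff_mul cF₂ pF₂ cP₂ pP₂)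
  have hs : ∀ n : Fin 2 → ℤ, n ≠ 0 → starRingEnd ℂ (cellCoeff F₁ n) * cellCoeff P₁ n +
      starRingEnd ℂ (cellCoeff F₂ n) * cellCoeff P₂ n = 0 := by
    intro n hn
    have h1 := congrArg (starRingEnd ℂ) (hF n)
    have h2 := hP n
    have h3 : cellCoeff (-P₁) n = - cellCoeff P₁ n := by
      simp [cellCoeff, cellInt, integral_neg]
    rw [h3] at h2
    simp only [map_add, map_mul, map_intCast, map_zero] at h1
    have hn' : n 0 ≠ 0 ∨ n 1 ≠ 0 := by
      by_contra! h0
      exact hn (by ext i; fin_cases i <;> simp [h0.1, h0.2])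
    rcases hn' with h0 | h0
    · have : (n 0 : ℂ) ≠ 0 := by exact_mod_cast h0
      apply mul_left_cancel₀ this
      linear_combination cellCoeff P₁ n * h1 + starRingEnd ℂ (cellCoeff F₂ n) * h2
    · have : (n 1 : ℂ) ≠ 0 := by exact_mod_cast h0
      apply mul_left_cancel₀ this
      linear_combination cellCoeff P₂ n * h1 - starRingEnd ℂ (cellCoeff F₁ n) * h2
  have h' := h.unique (hasSum_single 0 hs)
  simp only [cellCoeff_zero, Complex.conj_ofReal] at h'
  rw [cellInt_add (by fun_prop) (by fun_prop)]
  exact_mod_cast h'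

lemma WeakDivFree.fourierDivFree (h : WeakDivFree F₁ F₂)
    (h₁ : Continuous F₁) (h₂ : Continuous F₂) (hp₁ : IsPlanePeriodic F₁)
    (hp₂ : IsPlanePeriodic F₂) : FourierDivFree F₁ F₂ := by
  intro n
  set θ : ℝ × ℝ → ℝ := fun z => 2 * Real.pi * (n 0 * z.1 + n 1 * z.2) with hθ
  have hθc : ContDiff ℝ (⊤ : ℕ∞) θ := by fun_prop
  have hθx : ∀ z : ℝ × ℝ, HasDerivAt (fun s => θ (s, z.2)) (2 * Real.pi * n 0) z.1 := fun z => by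
    simpa using (((hasDerivAt_id z.1).const_mul (n 0 : ℝ)).add_const (n 1 * z.2)).const_mul
      (2 * Real.pi)
  have hθy : ∀ z : ℝ × ℝ, HasDerivAt (fun s => θ (z.1, s)) (2 * Real.pi * n 1) z.2 := fun z => by
    simpa using (((hasDerivAt_id z.2).const_mul (n 1 : ℝ)).const_add (n 0 * z.1)).const_mul
      (2 * Real.pi)
  have hch : ∀ z, planeChar (-n) z = (Real.cos (θ z) : ℂ) - (Real.sin (θ z) : ℂ) * Complex.I := by
    intro z
    have : planeChar (-n) z = Complex.exp (((-θ z : ℝ) : ℂ) * Complex.I) := by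
      simp only [planeChar, hθ]
      congr 3
      push_cast [Pi.neg_apply]
      ring
    rw [this, Complex.exp_mul_I]
    push_cast
    rw [Complex.cos_neg, Complex.sin_neg]
    ring
  have hper : ∀ x y, Real.cos (θ (x + 1, y)) = Real.cos (θ (x, y)) ∧
      Real.sin (θ (x + 1, y)) = Real.sin (θ (x, y)) ∧
      Real.cos (θ (x, y + 1)) = Real.cos (θ (x, y)) ∧
      Real.sin (θ (x, y + 1)) = Real.sin (θ (x, y)) := by
    intro x y
    have e1 : θ (x + 1, y) = θ (x, y) + n 0 * (2 * Real.pi) := by simp only [hθ]; ring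
    have e2 : θ (x, y + 1) = θ (x, y) + n 1 * (2 * Real.pi) := by simp only [hθ]; ring
    simp only [e1, e2, Real.cos_add_int_mul_two_pi, Real.sin_add_int_mul_two_pi, and_self]
  have hsin := h.cellInt_eq_zero h₁ h₂ hp₁ hp₂ (Real.contDiff_sin.comp hθc)
    fun x y => ⟨(hper x y).2.1, (hper x y).2.2.2⟩
  have hcos := h.cellInt_eq_zero h₁ h₂ hp₁ hp₂ (Real.contDiff_cos.comp hθc)
    fun x y => ⟨(hper x y).1, (hper x y).2.2.1⟩
  have dsx : ∀ z, dx (Real.sin ∘ θ) z = Real.cos (θ z) * (2 * Real.pi * n 0) := fun z =>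
    dx_eq_of_hasDerivAt ((Real.contDiff_sin.comp hθc).differentiable (by simp) z) (hθx z).sin
  have dsy : ∀ z, dy (Real.sin ∘ θ) z = Real.cos (θ z) * (2 * Real.pi * n 1) := fun z =>
    dy_eq_of_hasDerivAt ((Real.contDiff_sin.comp hθc).differentiable (by simp) z) (hθy z).sin
  have dcx : ∀ z, dx (Real.cos ∘ θ) z = -Real.sin (θ z) * (2 * Real.pi * n 0) := fun z =>
    dx_eq_of_hasDerivAt ((Real.contDiff_cos.comp hθc).differentiable (by simp) z) (hθx z).cos
  have dcy : ∀ z, dy (Real.cos ∘ θ) z = -Real.sin (θ z) * (2 * Real.pi * n 1) := fun z =>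
    dy_eq_of_hasDerivAt ((Real.contDiff_cos.comp hθc).differentiable (by simp) z) (hθy z).cos
  simp only [dsx, dsy] at hsin
  simp only [dcx, dcy] at hcos
  have cθ : Continuous θ := hθc.continuous
  have split : ∀ z, (n 0 : ℂ) * (planeChar (-n) z * (F₁ z : ℂ)) +
      (n 1 : ℂ) * (planeChar (-n) z * (F₂ z : ℂ)) = (1 / (2 * Real.pi) : ℂ) *
      (((F₁ z * (Real.cos (θ z) * (2 * Real.pi * n 0)) +
        F₂ z * (Real.cos (θ z) * (2 * Real.pi * n 1)) : ℝ) : ℂ) +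
      Complex.I * ((F₁ z * (-Real.sin (θ z) * (2 * Real.pi * n 0)) +
        F₂ z * (-Real.sin (θ z) * (2 * Real.pi * n 1)) : ℝ) : ℂ)) := by
    intro z
    have hpi : (Real.pi : ℂ) ≠ 0 := by exact_mod_cast Real.pi_ne_zero
    rw [hch]
    push_cast
    field_simp
    ring
  have cch := (contDiff_planeChar (-n) (N := 1)).continuous
  have e1 : (n 0 : ℂ) * cellCoeff F₁ n + (n 1 : ℂ) * cellCoeff F₂ n =
      cellInt fun z => (n 0 : ℂ) * (planeChar (-n) z * (F₁ z : ℂ)) +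
      (n 1 : ℂ) * (planeChar (-n) z * (F₂ z : ℂ)) := by
    rw [cellInt_add (by fun_prop) (by fun_prop)]
    simp only [cellCoeff, cellInt, integral_const_mul]
  rw [e1]
  simp only [split]
  unfold cellInt at hsin hcos ⊢
  rw [integral_const_mul, integral_add, integral_const_mul, integral_complex_ofReal,
    integral_complex_ofReal, hsin, hcos]
  · simp
  all_goals exact Continuous.integrableOn_cell (by fun_prop)

lemma contDiff_dx {n m : WithTop ℕ∞} (hf : ContDiff ℝ n f) (h : m + 1 ≤ n) :
    ContDiff ℝ m (dx f) := (hf.fderiv_right h).clm_apply contDiff_const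

lemma contDiff_dy {n m : WithTop ℕ∞} (hf : ContDiff ℝ n f) (h : m + 1 ≤ n) :
    ContDiff ℝ m (dy f) := (hf.fderiv_right h).clm_apply contDiff_const

lemma dy_dx (hf : ContDiff ℝ 2 f) (z : ℝ × ℝ) : dy (dx f) z = dx (dy f) z := by
  have h : IsSymmSndFDerivAt ℝ f z := hf.contDiffAt.isSymmSndFDerivAt (by simp)
  have hd : DifferentiableAt ℝ (fderiv ℝ f) z :=
    (hf.fderiv_right (m := 1) le_rfl).differentiable one_ne_zero z
  have e : ∀ v w, fderiv ℝ (fun y => fderiv ℝ f y v) z w = fderiv ℝ (fderiv ℝ f) z w v := by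
    intro v w
    rw [fderiv_clm_apply hd (differentiableAt_const v)]
    simp
  exact (e _ _).trans ((h.eq _ _).trans (e _ _).symm)

lemma hasCompactSupport_dx (hf : HasCompactSupport f) : HasCompactSupport (dx f) :=
  hf.fderiv_apply ℝ _

lemma hasCompactSupport_dy (hf : HasCompactSupport f) : HasCompactSupport (dy f) :=
  hf.fderiv_apply ℝ _

lemma integral_mul_dx (hf : ContDiff ℝ 1 f) (hg : ContDiff ℝ 1 g) (hs : HasCompactSupport g) :
    ∫ z, f z * dx g z = -∫ z, dx f z * g z := by
  have := continuous_dx hf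
  have := continuous_dx hg
  have := hf.continuous
  have := hg.continuous
  apply integral_mul_fderiv_eq_neg_fderiv_mul_of_integrable
  · exact Continuous.integrable_of_hasCompactSupport (by fun_prop) hs.mul_left
  · exact Continuous.integrable_of_hasCompactSupport (by fun_prop)
      (hasCompactSupport_dx hs).mul_left
  · exact Continuous.integrable_of_hasCompactSupport (by fun_prop) hs.mul_left
  · exact fun z _ => hf.differentiable one_ne_zero z
  · exact fun z _ => hg.differentiable one_ne_zero z

lemma integral_mul_dy (hf : ContDiff ℝ 1 f) (hg : ContDiff ℝ 1 g) (hs : HasCompactSupport g) :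
    ∫ z, f z * dy g z = -∫ z, dy f z * g z := by
  have := continuous_dy hf
  have := continuous_dy hg
  have := hf.continuous
  have := hg.continuous
  apply integral_mul_fderiv_eq_neg_fderiv_mul_of_integrable
  · exact Continuous.integrable_of_hasCompactSupport (by fun_prop) hs.mul_left
  · exact Continuous.integrable_of_hasCompactSupport (by fun_prop)
      (hasCompactSupport_dy hs).mul_left
  · exact Continuous.integrable_of_hasCompactSupport (by fun_prop) hs.mul_left
  · exact fun z _ => hf.differentiable one_ne_zero z
  · exact fun z _ => hg.differentiable one_ne_zero z

/-- Rotated gradients are divergence-free. -/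
lemma weakDivFree_rotated_gradient (hu : ContDiff ℝ 1 u) : WeakDivFree (dy u) (-dx u) := by
  intro φ hφ hs
  have hφ2 : ContDiff ℝ 2 φ := contDiff_infty.1 hφ 2
  have hφ1 : ContDiff ℝ 1 φ := hφ.of_le (by exact_mod_cast le_top)
  have h1 := integral_mul_dy hu (contDiff_dx hφ2 (m := 1) le_rfl) (hasCompactSupport_dx hs)
  have h2 := integral_mul_dx hu (contDiff_dy hφ2 (m := 1) le_rfl) (hasCompactSupport_dy hs)
  simp only [dy_dx hφ2] at h1
  have c1 := continuous_dx hu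
  have c2 := continuous_dy hu
  have c3 := continuous_dx hφ1
  have c4 := continuous_dy hφ1
  simp only [Pi.neg_apply, neg_mul, ← sub_eq_add_neg]
  rw [integral_sub]
  · linarith
  · exact Continuous.integrable_of_hasCompactSupport (by fun_prop)
      (hasCompactSupport_dx hs).mul_left
  · exact Continuous.integrable_of_hasCompactSupport (by fun_prop)
      (hasCompactSupport_dy hs).mul_left

/-- The Jacobian is a null Lagrangian. -/
lemma cellInt_jacobian (hf : ContDiff ℝ 1 f) (hg : ContDiff ℝ 1 g)
    (pf₁ : IsPlanePeriodic (dx f)) (pf₂ : IsPlanePeriodic (dy f))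
    (pg₁ : IsPlanePeriodic (dx g)) (pg₂ : IsPlanePeriodic (dy g)) :
    cellInt (fun z => dx f z * dy g z - dy f z * dx g z) =
      cellInt (dx f) * cellInt (dy g) - cellInt (dy f) * cellInt (dx g) := by
  have cf₁ := continuous_dx hf
  have cf₂ := continuous_dy hf
  have cg₁ := continuous_dx hg
  have cg₂ := continuous_dy hg
  have neg : ∀ {h : ℝ × ℝ → ℝ}, IsPlanePeriodic h → IsPlanePeriodic (-h) := fun hh x y => by
    simp [hh x y]
  have h := FourierDivFree.cellInt_inner
    ((weakDivFree_rotated_gradient hg).fourierDivFree cg₂ cg₁.neg pg₂ (neg pg₁))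
    ((weakDivFree_rotated_gradient hf).fourierDivFree cf₂ cf₁.neg pf₂ (neg pf₁))
    cg₂ cg₁.neg cf₁ cf₂ pg₂ (neg pg₁) pf₁ pf₂
  have h3 : cellInt (-dx g) = -cellInt (dx g) := by
    simp [cellInt, integral_neg]
  rw [h3] at h
  calc _ = cellInt (fun z => dy g z * dx f z + (-dx g) z * dy f z) := by
        congr 1; ext z; simp only [Pi.neg_apply]; ring
    _ = _ := by rw [h]; ring

end Hodge

/-- The difference quotient with step `v` and factor `r`. -/
def diffQuot (r : ℝ) (v : ℝ × ℝ) (f : ℝ × ℝ → ℝ) (z : ℝ × ℝ) : ℝ := r * (f (z + v) - f z)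

section DiffQuot

variable {f g a p q : ℝ × ℝ → ℝ} {r M : ℝ} {v : ℝ × ℝ}

lemma IsPlanePeriodic.comp_add {α : Type*} {f : ℝ × ℝ → α} (hf : IsPlanePeriodic f) (v : ℝ × ℝ) :
    IsPlanePeriodic fun z => f (z + v) := by
  intro x y
  have h := hf (x + v.1) (y + v.2)
  constructor
  · have e : ((x + 1, y) : ℝ × ℝ) + v = (x + v.1 + 1, y + v.2) := by ext <;> simp; ring
    simp only [e, h.1]; rfl
  · have e : ((x, y + 1) : ℝ × ℝ) + v = (x + v.1, y + v.2 + 1) := by ext <;> simp; ring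
    simp only [e, h.2]; rfl

lemma IsPlanePeriodic.cellInt_comp_add {E : Type*} [NormedAddCommGroup E] [NormedSpace ℝ E]
    {f : ℝ × ℝ → E} (hp : IsPlanePeriodic f) (hf : Continuous f)
    (v : ℝ × ℝ) : cellInt (fun z => f (z + v)) = cellInt f := by
  rw [← IsPlanePeriodic.cell_shift hf hp v.1 v.2, cellInt_eq_iterated (by fun_prop)]
  have h : ∀ x : ℝ, ∫ y in (0 : ℝ)..1, f ((x, y) + v) =
      ∫ y in v.2..v.2 + 1, f (x + v.1, y) := fun x => by
    have := intervalIntegral.integral_comp_add_right (a := 0) (b := 1)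
      (fun y => f (x + v.1, y)) v.2
    rw [zero_add, add_comm 1] at this
    exact this
  simp only [h]
  have := intervalIntegral.integral_comp_add_right (a := 0) (b := 1)
    (fun x => ∫ y in v.2..v.2 + 1, f (x, y)) v.1
  rw [zero_add, add_comm 1] at this
  exact this

lemma Continuous.diffQuot (hf : Continuous f) : Continuous (diffQuot r v f) := by
  unfold _root_.diffQuot; fun_prop

lemma Continuous.diffQuot_iterate (hf : Continuous f) (k : ℕ) :
    Continuous ((_root_.diffQuot r v)^[k] f) := by
  induction k generalizing f with
  | zero => exact hf
  | succ k ih => exact ih hf.diffQuot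

lemma IsPlanePeriodic.diffQuot (hf : IsPlanePeriodic f) : IsPlanePeriodic (diffQuot r v f) :=
  (hf.comp_add v).comp₂ hf fun s t => r * (s - t)

lemma IsPlanePeriodic.diffQuot_iterate (hf : IsPlanePeriodic f) (k : ℕ) :
    IsPlanePeriodic ((_root_.diffQuot r v)^[k] f) := by
  induction k generalizing f with
  | zero => exact hf
  | succ k ih => exact ih hf.diffQuot

lemma diffQuot_add : diffQuot r v (f + g) = diffQuot r v f + diffQuot r v g := by
  ext z; simp only [diffQuot, Pi.add_apply]; ring

lemma diffQuot_iterate_add (k : ℕ) :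
    (diffQuot r v)^[k] (f + g) = (diffQuot r v)^[k] f + (diffQuot r v)^[k] g := by
  induction k generalizing f g with
  | zero => rfl
  | succ k ih => simp only [Function.iterate_succ_apply, diffQuot_add, ih]

lemma diffQuot_iterate_comp_add (w : ℝ × ℝ) (k : ℕ) :
    (diffQuot r v)^[k] (fun z => f (z + w)) = fun z => (diffQuot r v)^[k] f (z + w) := by
  induction k generalizing f with
  | zero => rfl
  | succ k ih =>
    rw [Function.iterate_succ_apply, Function.iterate_succ_apply, ← ih]
    congr 1
    ext z
    simp only [diffQuot, add_right_comm]

lemma cellInt_diffQuot (hf : Continuous f) (hp : IsPlanePeriodic f) :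
    cellInt (diffQuot r v f) = 0 := by
  unfold diffQuot
  rw [cellInt_const_mul, cellInt_sub (by fun_prop) hf, hp.cellInt_comp_add hf, sub_self, mul_zero]

lemma cellCoeff_diffQuot (hf : Continuous f) (hp : IsPlanePeriodic f) (n : Fin 2 → ℤ) :
    cellCoeff (diffQuot r v f) n = r * (planeChar n v - 1) * cellCoeff f n := by
  have hc := (contDiff_planeChar (-n) (N := 1)).continuous
  have h1 : cellInt (fun z => planeChar (-n) z * (f (z + v) : ℂ)) =
      planeChar n v * cellCoeff f n := by
    have h2 : IsPlanePeriodic fun z => planeChar (-n) z * (f z : ℂ) :=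
      (isPlanePeriodic_planeChar _).comp₂ hp fun (s : ℂ) (t : ℝ) => s * (t : ℂ)
    have h3 := h2.cellInt_comp_add (by fun_prop) v
    have h4 : planeChar n v * planeChar (-n) v = 1 := by
      simp only [planeChar, ← Complex.exp_add]
      rw [← Complex.exp_zero]
      congr 1
      push_cast [Pi.neg_apply]
      ring
    rw [cellCoeff, ← h3, cellInt, cellInt, ← integral_const_mul]
    congr 1
    ext z
    rw [planeChar_add]
    linear_combination (-planeChar (-n) z * (f (z + v) : ℂ)) * h4
  have h5 : ∀ z, planeChar (-n) z * (diffQuot r v f z : ℂ) =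
      (r : ℂ) * (planeChar (-n) z * (f (z + v) : ℂ) - planeChar (-n) z * (f z : ℂ)) := by
    intro z
    simp only [diffQuot]
    push_cast
    ring
  rw [cellCoeff]
  simp only [h5]
  have h6 := cellInt_sub (f := fun z => planeChar (-n) z * (f (z + v) : ℂ))
    (g := fun z => planeChar (-n) z * (f z : ℂ)) (by fun_prop) (by fun_prop)
  rw [h1] at h6
  change _ = _ - cellCoeff f n at h6
  rw [mul_assoc, sub_mul, one_mul, ← h6, cellInt, cellInt, ← integral_const_mul]

lemma cellCoeff_diffQuot_iterate (hf : Continuous f) (hp : IsPlanePeriodic f) (n : Fin 2 → ℤ)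
    (k : ℕ) :
    cellCoeff ((diffQuot r v)^[k] f) n = (r * (planeChar n v - 1)) ^ k * cellCoeff f n := by
  induction k generalizing f with
  | zero => simp
  | succ k ih =>
    rw [Function.iterate_succ_apply, ih hf.diffQuot hp.diffQuot, cellCoeff_diffQuot hf hp, pow_succ]
    ring

/-- The commutator of iterated difference quotients and multiplication. -/
def diffComm (r : ℝ) (v : ℝ × ℝ) (k : ℕ) (a p : ℝ × ℝ → ℝ) (z : ℝ × ℝ) : ℝ :=
  (diffQuot r v)^[k] (a * p) z - a (z + k • v) * (diffQuot r v)^[k] p z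

lemma continuous_diffComm (ha : Continuous a) (hp : Continuous p) (k : ℕ) :
    Continuous (diffComm r v k a p) := by
  have h1 := (ha.mul hp).diffQuot_iterate (r := r) (v := v) k
  have h2 := hp.diffQuot_iterate (r := r) (v := v) k
  unfold diffComm
  exact h1.sub (by fun_prop)

lemma diffComm_succ (k : ℕ) (z : ℝ × ℝ) : diffComm r v (k + 1) a p z =
    diffComm r v k (fun z => a (z + v)) (diffQuot r v p) z +
      diffQuot r v a (z + k • v) * (diffQuot r v)^[k] p z +
      diffComm r v k (diffQuot r v a) p z := by
  have h : diffQuot r v (a * p) =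
      (fun z => a (z + v)) * diffQuot r v p + diffQuot r v a * p := by
    ext z
    simp only [diffQuot, Pi.add_apply, Pi.mul_apply]
    ring
  simp only [diffComm, Function.iterate_succ_apply, h, diffQuot_iterate_add, Pi.add_apply,
    succ_nsmul, add_assoc]
  ring

lemma cellInt_sq_add_le (hf : Continuous f) (hg : Continuous g) :
    cellInt (fun z => (f z + g z) ^ 2) ≤
      2 * cellInt (fun z => f z ^ 2) + 2 * cellInt (fun z => g z ^ 2) := by
  rw [← cellInt_const_mul, ← cellInt_const_mul, ← cellInt_add (by fun_prop) (by fun_prop)]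
  exact cellInt_mono (by fun_prop) (by fun_prop) fun z => by nlinarith [sq_nonneg (f z - g z)]

lemma cellInt_sq_mul_le (hf : Continuous f) (hg : Continuous g) (hb : ∀ z, |f z| ≤ M) :
    cellInt (fun z => (f z * g z) ^ 2) ≤ M ^ 2 * cellInt (fun z => g z ^ 2) := by
  rw [← cellInt_const_mul]
  refine cellInt_mono (by fun_prop) (by fun_prop) fun z => ?_
  rw [mul_pow]
  exact mul_le_mul_of_nonneg_right (sq_le_sq' (abs_le.1 (hb z)).1 (abs_le.1 (hb z)).2) (sq_nonneg _)

lemma cellInt_nonneg (h : ∀ z, 0 ≤ f z) : 0 ≤ cellInt f :=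
  integral_nonneg h

lemma exists_cellInt_diffComm_sq_le (k : ℕ) : ∃ C : ℝ, 0 ≤ C ∧ ∀ (r M : ℝ) (v : ℝ × ℝ)
    (a p : ℝ × ℝ → ℝ), Continuous a → Continuous p →
    (∀ j ≤ k, ∀ z, |(diffQuot r v)^[j] a z| ≤ M) →
    cellInt (fun z => diffComm r v k a p z ^ 2) ≤
      C * M ^ 2 * ∑ i ∈ Finset.range k, cellInt (fun z => ((diffQuot r v)^[i] p z) ^ 2) := by
  induction k with
  | zero => exact ⟨0, le_rfl, fun r M v a p _ _ _ => by simp [diffComm, cellInt]⟩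
  | succ k ih =>
    obtain ⟨C, hC, h⟩ := ih
    refine ⟨8 * C + 4, by positivity, fun r M v a p ha hp hM => ?_⟩
    have h1 := h r M v (fun z => a (z + v)) (diffQuot r v p) (by fun_prop) hp.diffQuot
      fun j hj z => by rw [diffQuot_iterate_comp_add]; exact hM j (by omega) _
    have h2 := h r M v (diffQuot r v a) p ha.diffQuot hp
      fun j hj z => by rw [← Function.iterate_succ_apply]; exact hM (j + 1) (by omega) _
    have cD := hp.diffQuot_iterate (r := r) (v := v) k
    have ca := ha.diffQuot (r := r) (v := v)
    have c1 := continuous_diffComm (r := r) (v := v) (a := fun z => a (z + v))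
      (by fun_prop) (hp.diffQuot (r := r) (v := v)) k
    have c2 := continuous_diffComm (r := r) (v := v) ca hp k
    have h3 := cellInt_sq_mul_le (f := fun z => diffQuot r v a (z + k • v)) (M := M) (by fun_prop)
      cD fun z => hM 1 (by omega) _
    simp only [diffComm_succ]
    have h4 := cellInt_sq_add_le (f := fun z =>
      diffComm r v k (fun z => a (z + v)) (diffQuot r v p) z +
      diffQuot r v a (z + k • v) * (diffQuot r v)^[k] p z) (by fun_prop) c2
    have h5 := cellInt_sq_add_le (f := fun z =>
      diffComm r v k (fun z => a (z + v)) (diffQuot r v p) z)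
      (g := fun z => diffQuot r v a (z + k • v) * (diffQuot r v)^[k] p z)
      (by fun_prop) (by fun_prop)
    have hnn : ∀ i, 0 ≤ cellInt (fun z => ((diffQuot r v)^[i] p z) ^ 2) := fun i =>
      cellInt_nonneg fun z => sq_nonneg _
    have s1 : ∑ i ∈ Finset.range k, cellInt (fun z => ((diffQuot r v)^[i] (diffQuot r v p) z) ^ 2) ≤
        ∑ i ∈ Finset.range (k + 1), cellInt (fun z => ((diffQuot r v)^[i] p z) ^ 2) := by
      rw [Finset.sum_range_succ']
      exact le_add_of_nonneg_right (hnn 0)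
    have s2 := Finset.sum_range_succ
      (fun i => cellInt (fun z => ((diffQuot r v)^[i] p z) ^ 2)) k
    have s3 := Finset.sum_nonneg fun i (_ : i ∈ Finset.range k) => hnn i
    set S := ∑ i ∈ Finset.range (k + 1), cellInt (fun z => ((diffQuot r v)^[i] p z) ^ 2)
    set S' := ∑ i ∈ Finset.range k, cellInt (fun z => ((diffQuot r v)^[i] p z) ^ 2)
    have hCM : 0 ≤ C * M ^ 2 := by positivity
    have b1 := h1.trans (mul_le_mul_of_nonneg_left s1 hCM)
    have b2 := h2.trans (mul_le_mul_of_nonneg_left (show S' ≤ S by linarith [hnn k]) hCM)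
    have b3 := h3.trans (mul_le_mul_of_nonneg_left (show _ ≤ S by linarith) (sq_nonneg M))
    have : (0 : ℝ) ≤ C * M ^ 2 * S := mul_nonneg hCM (by linarith [hnn k])
    nlinarith

end DiffQuot

section Energy

variable {f a b c p q : ℝ × ℝ → ℝ} {r M : ℝ} {v : ℝ × ℝ}

lemma cellCoeff_neg (f : ℝ × ℝ → ℝ) (n : Fin 2 → ℤ) : cellCoeff (-f) n = -cellCoeff f n := by
  simp [cellCoeff, cellInt, integral_neg]

/-- The quadratic energy of the `k`-th difference quotient of a field. -/
noncomputable def diffEnergy (r : ℝ) (v : ℝ × ℝ) (p q : ℝ × ℝ → ℝ) (k : ℕ) : ℝ :=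
  cellInt (fun z => ((diffQuot r v)^[k] p z) ^ 2) + cellInt (fun z => ((diffQuot r v)^[k] q z) ^ 2)

/-- Periodic continuous coefficients of an elliptic system, together with a curl-free field whose
flux is divergence-free. -/
structure EllipticData (a b c p q : ℝ × ℝ → ℝ) (l : ℝ) : Prop where
  ca : Continuous a
  cb : Continuous b
  cc : Continuous c
  cp : Continuous p
  cq : Continuous q
  pa : IsPlanePeriodic a
  pb : IsPlanePeriodic b
  pc : IsPlanePeriodic c
  pp : IsPlanePeriodic p
  pq : IsPlanePeriodic q
  pos : 0 < l
  elliptic : ∀ z s t, l * (s ^ 2 + t ^ 2) ≤ a z * s ^ 2 + 2 * b z * s * t + c z * t ^ 2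
  curl : FourierDivFree q (-p)
  div : FourierDivFree (a * p + b * q) (b * p + c * q)

lemma EllipticData.energy_identity {l : ℝ} (h : EllipticData a b c p q l) {k : ℕ} (hk : k ≠ 0) :
    cellInt (fun z => (diffQuot r v)^[k] (a * p + b * q) z * (diffQuot r v)^[k] p z +
      (diffQuot r v)^[k] (b * p + c * q) z * (diffQuot r v)^[k] q z) = 0 := by
  have cp := h.cp
  have cq := h.cq
  have cF₁ : Continuous (a * p + b * q) := (h.ca.mul cp).add (h.cb.mul cq)
  have cF₂ : Continuous (b * p + c * q) := (h.cb.mul cp).add (h.cc.mul cq)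
  have pF₁ : IsPlanePeriodic (a * p + b * q) :=
    (h.pa.comp₂ h.pp (· * ·)).comp₂ (h.pb.comp₂ h.pq (· * ·)) (· + ·)
  have pF₂ : IsPlanePeriodic (b * p + c * q) :=
    (h.pb.comp₂ h.pp (· * ·)).comp₂ (h.pc.comp₂ h.pq (· * ·)) (· + ·)
  have hmean : ∀ {g : ℝ × ℝ → ℝ}, Continuous g → IsPlanePeriodic g →
      cellInt ((diffQuot r v)^[k] g) = 0 := fun hg hgp => by
    obtain ⟨m, rfl⟩ := Nat.exists_eq_succ_of_ne_zero hk
    rw [Function.iterate_succ_apply']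
    exact cellInt_diffQuot (hg.diffQuot_iterate m) (hgp.diffQuot_iterate m)
  rw [FourierDivFree.cellInt_inner _ _ (cF₁.diffQuot_iterate k) (cF₂.diffQuot_iterate k)
    (cp.diffQuot_iterate k) (cq.diffQuot_iterate k) (pF₁.diffQuot_iterate k)
    (pF₂.diffQuot_iterate k) (h.pp.diffQuot_iterate k) (h.pq.diffQuot_iterate k),
    hmean cF₁ pF₁, hmean cF₂ pF₂, zero_mul, zero_mul, add_zero]
  · intro n
    rw [cellCoeff_diffQuot_iterate cF₁ pF₁, cellCoeff_diffQuot_iterate cF₂ pF₂]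
    linear_combination (r * (planeChar n v - 1)) ^ k * h.div n
  · intro n
    have h1 := h.curl n
    rw [cellCoeff_neg] at h1 ⊢
    rw [cellCoeff_diffQuot_iterate h.cp h.pp, cellCoeff_diffQuot_iterate h.cq h.pq]
    linear_combination (r * (planeChar n v - 1)) ^ k * h1

lemma EllipticData.sq_mul_diffEnergy_le {l : ℝ} (h : EllipticData a b c p q l) {k : ℕ}
    (hk : k ≠ 0) : l ^ 2 * diffEnergy r v p q k ≤
      2 * (cellInt (fun z => diffComm r v k a p z ^ 2) +
        cellInt (fun z => diffComm r v k b q z ^ 2) +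
      (cellInt (fun z => diffComm r v k b p z ^ 2) +
        cellInt (fun z => diffComm r v k c q z ^ 2))) := by
  have hid := h.energy_identity (r := r) (v := v) hk
  have cP := h.cp.diffQuot_iterate (r := r) (v := v) k
  have cQ := h.cq.diffQuot_iterate (r := r) (v := v) k
  have ca := h.ca
  have cb := h.cb
  have cc := h.cc
  have c1 := continuous_diffComm (r := r) (v := v) h.ca h.cp k
  have c2 := continuous_diffComm (r := r) (v := v) h.cb h.cq k
  have c3 := continuous_diffComm (r := r) (v := v) h.cb h.cp k
  have c4 := continuous_diffComm (r := r) (v := v) h.cc h.cq k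
  have e1 : ∀ (f g s t : ℝ × ℝ → ℝ) (z : ℝ × ℝ), (diffQuot r v)^[k] (f * s + g * t) z =
      f (z + k • v) * (diffQuot r v)^[k] s z + g (z + k • v) * (diffQuot r v)^[k] t z +
      (diffComm r v k f s z + diffComm r v k g t z) := by
    intro f g s t z
    rw [diffQuot_iterate_add, Pi.add_apply, diffComm, diffComm]
    ring
  simp only [e1] at hid
  have hl := h.pos
  have key : l / 2 * diffEnergy r v p q k ≤ 1 / (2 * l) *
      (cellInt (fun z => (diffComm r v k a p z + diffComm r v k b q z) ^ 2) +
      cellInt (fun z => (diffComm r v k b p z + diffComm r v k c q z) ^ 2)) := by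
    rw [diffEnergy, ← cellInt_add (by fun_prop) (by fun_prop),
      ← cellInt_add (by fun_prop) (by fun_prop), ← cellInt_const_mul, ← cellInt_const_mul,
      ← sub_nonneg, ← cellInt_sub (by fun_prop) (by fun_prop),
      ← add_zero (cellInt _)]
    nth_rewrite 2 [← hid]
    rw [← cellInt_add (by fun_prop) (by fun_prop)]
    refine cellInt_nonneg fun z => ?_
    have he := h.elliptic (z + k • v) ((diffQuot r v)^[k] p z) ((diffQuot r v)^[k] q z)
    generalize (diffQuot r v)^[k] p z = P at *
    generalize (diffQuot r v)^[k] q z = Q at *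
    generalize diffComm r v k a p z + diffComm r v k b q z = R at *
    generalize diffComm r v k b p z + diffComm r v k c q z = S at *
    have y : 0 ≤ 1 / (2 * l) * ((R + l * P) ^ 2 + (S + l * Q) ^ 2) := by positivity
    have y' : 1 / (2 * l) * ((R + l * P) ^ 2 + (S + l * Q) ^ 2) =
        1 / (2 * l) * (R ^ 2 + S ^ 2) + (R * P + S * Q) + l / 2 * (P ^ 2 + Q ^ 2) := by
      field_simp
      ring
    linarith
  have s1 := cellInt_sq_add_le c1 c2
  have s2 := cellInt_sq_add_le c3 c4
  have key' := mul_le_mul_of_nonneg_left key (show 0 ≤ 2 * l by positivity)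
  rw [← mul_assoc (2 * l) (1 / (2 * l)), mul_one_div_cancel (by positivity), one_mul] at key'
  linarith

lemma EllipticData.exists_diffEnergy_le {l : ℝ} (h : EllipticData a b c p q l) (M : ℝ) (k : ℕ) :
    ∃ K : ℝ, ∀ (r : ℝ) (v : ℝ × ℝ), (∀ j ≤ k, ∀ z, |(diffQuot r v)^[j] a z| ≤ M ∧
      |(diffQuot r v)^[j] b z| ≤ M ∧ |(diffQuot r v)^[j] c z| ≤ M) →
      ∀ i ≤ k, diffEnergy r v p q i ≤ K := by
  induction k with
  | zero =>
    refine ⟨diffEnergy 0 0 p q 0, fun r v _ i hi => ?_⟩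
    obtain rfl := Nat.le_zero.1 hi
    rfl
  | succ k ih =>
    obtain ⟨K, hK⟩ := ih
    obtain ⟨C, hC, hCb⟩ := exists_cellInt_diffComm_sq_le (k + 1)
    refine ⟨max K (4 * C * M ^ 2 * ((k + 1 : ℕ) * K) / l ^ 2), fun r v hM i hi => ?_⟩
    have hKi := hK r v fun j hj => hM j (by omega)
    rcases Nat.lt_or_ge i (k + 1) with hlt | hge
    · exact (hKi i (by omega)).trans (le_max_left _ _)
    obtain rfl : i = k + 1 := by omega
    refine le_trans ?_ (le_max_right _ _)
    have h1 := h.sq_mul_diffEnergy_le (r := r) (v := v) (k := k + 1) (by omega)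
    have b1 := hCb r M v a p h.ca h.cp fun j hj z => (hM j hj z).1
    have b2 := hCb r M v b q h.cb h.cq fun j hj z => (hM j hj z).2.1
    have b3 := hCb r M v b p h.cb h.cp fun j hj z => (hM j hj z).2.1
    have b4 := hCb r M v c q h.cc h.cq fun j hj z => (hM j hj z).2.2
    have hsum : ∑ i ∈ Finset.range (k + 1), cellInt (fun z => ((diffQuot r v)^[i] p z) ^ 2) +
        ∑ i ∈ Finset.range (k + 1), cellInt (fun z => ((diffQuot r v)^[i] q z) ^ 2) ≤
        (k + 1 : ℕ) * K := by
      rw [← Finset.sum_add_distrib]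
      have := Finset.sum_le_card_nsmul (Finset.range (k + 1)) (diffEnergy r v p q) K
        fun i hi => hKi i (by simpa [Nat.lt_succ_iff] using hi)
      rw [nsmul_eq_mul, Finset.card_range] at this
      exact this
    rw [le_div_iff₀ (pow_pos h.pos 2), mul_comm]
    have := mul_le_mul_of_nonneg_left hsum (show 0 ≤ C * M ^ 2 by positivity)
    linarith

end Energy

section Bounds

variable {f : ℝ × ℝ → ℝ}

/-- The directional derivative. -/
noncomputable def dirDeriv (e : ℝ × ℝ) (f : ℝ × ℝ → ℝ) (z : ℝ × ℝ) : ℝ := fderiv ℝ f z e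

lemma contDiff_dirDeriv (e : ℝ × ℝ) (hf : ContDiff ℝ (⊤ : ℕ∞) f) :
    ContDiff ℝ (⊤ : ℕ∞) (dirDeriv e f) :=
  (hf.fderiv_right (m := (⊤ : ℕ∞)) le_rfl).clm_apply contDiff_const

lemma contDiff_dirDeriv_iterate (e : ℝ × ℝ) (hf : ContDiff ℝ (⊤ : ℕ∞) f) (k : ℕ) :
    ContDiff ℝ (⊤ : ℕ∞) ((dirDeriv e)^[k] f) := by
  induction k generalizing f with
  | zero => exact hf
  | succ k ih => exact ih (contDiff_dirDeriv e hf)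

lemma isPlanePeriodic_dirDeriv_iterate (e : ℝ × ℝ) (hf : IsPlanePeriodic f) (k : ℕ) :
    IsPlanePeriodic ((dirDeriv e)^[k] f) := by
  induction k generalizing f with
  | zero => exact hf
  | succ k ih =>
    refine ih (fun x y => ?_)
    have := isPlanePeriodic_fderiv hf x y
    simp only [dirDeriv, this.1, this.2, and_self]

lemma contDiff_diffQuot {n : WithTop ℕ∞} (r : ℝ) (v : ℝ × ℝ) (hf : ContDiff ℝ n f) :
    ContDiff ℝ n (diffQuot r v f) :=
  contDiff_const.mul ((hf.comp (contDiff_id.add contDiff_const)).sub hf)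

lemma dirDeriv_diffQuot (e : ℝ × ℝ) (r : ℝ) (v : ℝ × ℝ) (hf : Differentiable ℝ f) :
    dirDeriv e (diffQuot r v f) = diffQuot r v (dirDeriv e f) := by
  ext z
  have h1 : HasFDerivAt (fun z => f (z + v)) (fderiv ℝ f (z + v)) z :=
    (hasFDerivAt_comp_add_right v).2 (hf (z + v)).hasFDerivAt
  have h2 : HasFDerivAt (diffQuot r v f) (r • (fderiv ℝ f (z + v) - fderiv ℝ f z)) z :=
    (h1.sub (hf z).hasFDerivAt).const_mul r
  simp [dirDeriv, h2.fderiv, diffQuot]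

lemma dirDeriv_iterate_diffQuot (e : ℝ × ℝ) (r : ℝ) (v : ℝ × ℝ) (hf : ContDiff ℝ (⊤ : ℕ∞) f)
    (k : ℕ) : (dirDeriv e)^[k] (diffQuot r v f) = diffQuot r v ((dirDeriv e)^[k] f) := by
  induction k generalizing f with
  | zero => rfl
  | succ k ih =>
    rw [Function.iterate_succ_apply, dirDeriv_diffQuot e r v (hf.differentiable (by simp)),
      ih (contDiff_dirDeriv e hf), Function.iterate_succ_apply]

lemma abs_diffQuot_le {e : ℝ × ℝ} {h B : ℝ} (hh : 0 < h) (hf : Differentiable ℝ f)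
    (hB : ∀ z, |dirDeriv e f z| ≤ B) (z : ℝ × ℝ) : |diffQuot h⁻¹ (h • e) f z| ≤ B := by
  have hd : ∀ s : ℝ, HasDerivAt (fun s : ℝ => f (z + s • e)) (dirDeriv e f (z + s • e)) s := by
    intro s
    have h1 : HasDerivAt (fun s : ℝ => z + s • e) e s := by
      simpa using ((hasDerivAt_id s).smul_const e).const_add z
    exact (hf (z + s • e)).hasFDerivAt.comp_hasDerivAt s h1
  have := Convex.norm_image_sub_le_of_norm_hasDerivWithin_le (s := Set.univ) (x := 0) (y := h)
    (fun s _ => (hd s).hasDerivWithinAt) (fun s _ => hB _) convex_univ trivial trivial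
  simp only [zero_smul, add_zero, sub_zero, Real.norm_eq_abs, abs_of_pos hh] at this
  rw [diffQuot, abs_mul, abs_of_pos (inv_pos.2 hh), inv_mul_le_iff₀ hh, mul_comm]
  exact this

lemma abs_diffQuot_iterate_le {e : ℝ × ℝ} {h B : ℝ} (hh : 0 < h) (hf : ContDiff ℝ (⊤ : ℕ∞) f)
    (k : ℕ) (hB : ∀ z, |(dirDeriv e)^[k] f z| ≤ B) (z : ℝ × ℝ) :
    |(diffQuot h⁻¹ (h • e))^[k] f z| ≤ B := by
  induction k generalizing f with
  | zero => exact hB z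
  | succ k ih =>
    rw [Function.iterate_succ_apply]
    refine ih (contDiff_diffQuot _ _ hf) fun w => ?_
    rw [dirDeriv_iterate_diffQuot e _ _ hf]
    refine abs_diffQuot_le hh
      ((contDiff_dirDeriv_iterate e hf k).differentiable (by simp)) (fun y => ?_) w
    rw [← Function.iterate_succ_apply' (dirDeriv e)]
    exact hB y

lemma exists_bound_diffQuot_iterate (e : ℝ × ℝ) (hf : ContDiff ℝ (⊤ : ℕ∞) f)
    (hp : IsPlanePeriodic f) (k : ℕ) : ∃ M, ∀ h : ℝ, 0 < h → ∀ j ≤ k, ∀ z,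
      |(diffQuot h⁻¹ (h • e))^[j] f z| ≤ M := by
  have h1 : ∀ j, ∃ B > 0, ∀ z, |(dirDeriv e)^[j] f z| ≤ B := fun j =>
    (isPlanePeriodic_dirDeriv_iterate e hp j).exists_bound
      (contDiff_dirDeriv_iterate e hf j).continuous
  choose B hB0 hB using h1
  refine ⟨∑ i ∈ Finset.range (k + 1), B i, fun h hh j hj z => ?_⟩
  refine (abs_diffQuot_iterate_le hh hf j (hB j) z).trans ?_
  exact Finset.single_le_sum (fun i _ => (hB0 i).le) (Finset.mem_range.2 (by omega))

end Bounds

section Regularity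

open Filter Topology

variable {f a b c p q : ℝ × ℝ → ℝ}

lemma hasDerivAt_planeChar_line (n : Fin 2 → ℤ) (e : ℝ × ℝ) :
    HasDerivAt (fun s : ℝ => planeChar n (s • e))
      ((2 * Real.pi * (n 0 * e.1 + n 1 * e.2) : ℝ) * Complex.I) 0 := by
  have h1 : HasDerivAt (fun s : ℝ => ((2 * Real.pi * (n 0 * (s • e).1 + n 1 * (s • e).2) : ℝ) : ℂ))
      ((2 * Real.pi * (n 0 * e.1 + n 1 * e.2) : ℝ) : ℂ) 0 := by
    apply HasDerivAt.ofReal_comp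
    have := (hasDerivAt_id (0 : ℝ)).mul_const (2 * Real.pi * (n 0 * e.1 + n 1 * e.2))
    rw [one_mul] at this
    refine this.congr_of_eventuallyEq (Eventually.of_forall fun s => ?_)
    simp only [Prod.smul_fst, Prod.smul_snd, smul_eq_mul, id]
    ring
  have h2 := (h1.mul_const Complex.I).cexp
  simpa [planeChar] using h2

lemma sum_cellCoeff_le (hc : Continuous f) (hp : IsPlanePeriodic f) {e : ℝ × ℝ} {k : ℕ} {K : ℝ}
    (hK : ∀ h : ℝ, 0 < h → cellInt (fun z => ((diffQuot h⁻¹ (h • e))^[k] f z) ^ 2) ≤ K)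
    (S : Finset (Fin 2 → ℤ)) :
    ∑ n ∈ S, (2 * Real.pi * (n 0 * e.1 + n 1 * e.2)) ^ (2 * k) * ‖cellCoeff f n‖ ^ 2 ≤ K := by
  have hlim : Tendsto (fun h : ℝ => ∑ n ∈ S,
      ‖((h⁻¹ : ℝ) * (planeChar n (h • e) - 1)) ^ k * cellCoeff f n‖ ^ 2) (𝓝[>] 0)
      (𝓝 (∑ n ∈ S, (2 * Real.pi * (n 0 * e.1 + n 1 * e.2)) ^ (2 * k) * ‖cellCoeff f n‖ ^ 2)) := by
    refine tendsto_finsetSum _ fun n _ => ?_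
    have h1 := (hasDerivAt_planeChar_line n e).tendsto_slope_zero_right
    have h2 := (((h1.pow k).mul_const (cellCoeff f n)).norm).pow 2
    convert h2 using 1
    · ext h
      simp [planeChar]
    · generalize (2 * Real.pi * (n 0 * e.1 + n 1 * e.2) : ℝ) = X
      rw [norm_mul, norm_pow, norm_mul, Complex.norm_I, mul_one, Complex.norm_real,
        Real.norm_eq_abs, mul_pow (|X| ^ k), ← pow_mul, mul_comm k 2, pow_mul, pow_mul, sq_abs]
  refine le_of_tendsto hlim (eventually_mem_nhdsWithin.mono fun h hh => ?_)
  refine le_trans ?_ (hK h hh)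
  have hs := hasSum_cellCoeff_sq (hc.diffQuot_iterate (r := h⁻¹) (v := h • e) k)
    (hp.diffQuot_iterate k)
  simp only [cellCoeff_diffQuot_iterate hc hp] at hs
  exact sum_le_hasSum S (fun n _ => by positivity) hs

lemma summable_norm_mul_cellCoeff (hc : Continuous f) (hp : IsPlanePeriodic f) {K : ℝ}
    (h₁ : ∀ h : ℝ, 0 < h →
      cellInt (fun z => ((diffQuot h⁻¹ (h • ((1, 0) : ℝ × ℝ)))^[3] f z) ^ 2) ≤ K)
    (h₂ : ∀ h : ℝ, 0 < h →
      cellInt (fun z => ((diffQuot h⁻¹ (h • ((0, 1) : ℝ × ℝ)))^[3] f z) ^ 2) ≤ K) :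
    Summable fun n : Fin 2 → ℤ => ‖n‖ * ‖cellCoeff f n‖ := by
  have hs : Summable fun n : Fin 2 → ℤ => ‖n‖ ^ 6 * ‖cellCoeff f n‖ ^ 2 := by
    refine summable_of_sum_le (c := 2 * K) (fun n => by positivity) fun S => ?_
    have s1 := sum_cellCoeff_le hc hp h₁ S
    have s2 := sum_cellCoeff_le hc hp h₂ S
    calc _ ≤ ∑ n ∈ S, ((2 * Real.pi * (n 0 * 1 + n 1 * 0)) ^ (2 * 3) * ‖cellCoeff f n‖ ^ 2 +
          (2 * Real.pi * (n 0 * 0 + n 1 * 1)) ^ (2 * 3) * ‖cellCoeff f n‖ ^ 2) := by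
          refine Finset.sum_le_sum fun n _ => ?_
          rw [← add_mul]
          refine mul_le_mul_of_nonneg_right ?_ (sq_nonneg _)
          have hpi : (1 : ℝ) ≤ (2 * Real.pi) ^ 6 := one_le_pow₀ (by linarith [Real.pi_gt_three])
          have e0 : (0 : ℝ) ≤ (n 0 : ℝ) ^ 6 := by positivity
          have e1 : (0 : ℝ) ≤ (n 1 : ℝ) ^ 6 := by positivity
          have hn : ‖n‖ ^ 6 ≤ (n 0 : ℝ) ^ 6 + (n 1 : ℝ) ^ 6 := by
            obtain ⟨i, hi⟩ : ∃ i, ‖n‖ ≤ ‖n i‖ := by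
              by_contra! h
              have := (pi_norm_lt_iff (x := n) ((norm_nonneg _).trans_lt (h 0))).2 h
              exact lt_irrefl _ this
            have e2 : ‖n i‖ ^ 6 = (n i : ℝ) ^ 6 := by
              rw [Int.norm_eq_abs, Even.pow_abs ⟨3, rfl⟩]
            calc ‖n‖ ^ 6 ≤ ‖n i‖ ^ 6 := by gcongr
              _ = (n i : ℝ) ^ 6 := e2
              _ ≤ _ := by fin_cases i <;> simp <;> linarith
          have r0 : (2 * Real.pi * (n 0 * 1 + n 1 * 0)) ^ (2 * 3) =
              (2 * Real.pi) ^ 6 * (n 0 : ℝ) ^ 6 := by ring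
          have r1 : (2 * Real.pi * (n 0 * 0 + n 1 * 1)) ^ (2 * 3) =
              (2 * Real.pi) ^ 6 * (n 1 : ℝ) ^ 6 := by ring
          rw [r0, r1]
          linarith [le_mul_of_one_le_left e0 hpi, le_mul_of_one_le_left e1 hpi]
      _ ≤ 2 * K := by rw [Finset.sum_add_distrib]; linarith
  have hs' := EisensteinSeries.summable_one_div_norm_rpow (k := 4) (by norm_num)
  refine Summable.of_nonneg_of_le (fun n => by positivity) (fun n => ?_) (hs.add hs')
  rcases eq_or_ne n 0 with rfl | hn
  · simp
  have hn0 : 0 < ‖n‖ := norm_pos_iff.2 hn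
  rw [Real.rpow_neg hn0.le, show (4 : ℝ) = (4 : ℕ) by norm_num, Real.rpow_natCast]
  have h5 : 0 ≤ (‖n‖ ^ 3 * ‖cellCoeff f n‖ - (‖n‖ ^ 2)⁻¹) ^ 2 := sq_nonneg _
  have h6 : (‖n‖ ^ 3 * ‖cellCoeff f n‖ - (‖n‖ ^ 2)⁻¹) ^ 2 = ‖n‖ ^ 6 * ‖cellCoeff f n‖ ^ 2 +
      (‖n‖ ^ 4)⁻¹ - 2 * (‖n‖ * ‖cellCoeff f n‖) := by
    field_simp
    ring
  have : 0 ≤ ‖n‖ * ‖cellCoeff f n‖ := by positivity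
  linarith

lemma norm_planeChar (n : Fin 2 → ℤ) (z : ℝ × ℝ) : ‖planeChar n z‖ = 1 :=
  Complex.norm_exp_ofReal_mul_I _

lemma norm_fderiv_planeChar_le (n : Fin 2 → ℤ) (z : ℝ × ℝ) :
    ‖fderiv ℝ (planeChar n) z‖ ≤ 4 * Real.pi * ‖n‖ := by
  refine ContinuousLinearMap.opNorm_le_bound _ (by positivity) fun e => ?_
  have h1 : HasDerivAt (fun s : ℝ => planeChar n (z + s • e))
      (planeChar n z * ((2 * Real.pi * (n 0 * e.1 + n 1 * e.2) : ℝ) * Complex.I)) 0 := by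
    simp only [planeChar_add]
    exact (hasDerivAt_planeChar_line n e).const_mul _
  have h2 : HasDerivAt (fun s : ℝ => planeChar n (z + s • e)) (fderiv ℝ (planeChar n) z e) 0 := by
    have h3 : HasDerivAt (fun s : ℝ => z + s • e) e 0 := by
      simpa using ((hasDerivAt_id (0 : ℝ)).smul_const e).const_add z
    have h4 := ((contDiff_planeChar n (N := 1)).differentiable one_ne_zero z).hasFDerivAt
    exact h4.comp_hasDerivAt_of_eq (0 : ℝ) h3 (by simp)
  rw [h2.unique h1, norm_mul, norm_planeChar, norm_mul, Complex.norm_I, Complex.norm_real,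
    one_mul, mul_one, Real.norm_eq_abs]
  have a0 : |(n 0 : ℝ)| ≤ ‖n‖ := by simpa [Int.norm_eq_abs] using norm_le_pi_norm n 0
  have a1 : |(n 1 : ℝ)| ≤ ‖n‖ := by simpa [Int.norm_eq_abs] using norm_le_pi_norm n 1
  have b0 : |e.1| ≤ ‖e‖ := norm_fst_le e
  have b1 : |e.2| ≤ ‖e‖ := norm_snd_le e
  rw [abs_mul, abs_of_pos Real.two_pi_pos]
  calc _ ≤ 2 * Real.pi * (|(n 0 : ℝ)| * |e.1| + |(n 1 : ℝ)| * |e.2|) := by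
        gcongr
        refine (abs_add_le _ _).trans ?_
        rw [abs_mul, abs_mul]
    _ ≤ 2 * Real.pi * (‖n‖ * ‖e‖ + ‖n‖ * ‖e‖) := by gcongr
    _ = _ := by ring

lemma contDiff_one_of_summable (hc : Continuous f) (hp : IsPlanePeriodic f)
    (h : Summable fun n : Fin 2 → ℤ => ‖n‖ * ‖cellCoeff f n‖) : ContDiff ℝ 1 f := by
  have h0 : Summable fun n : Fin 2 → ℤ => ‖cellCoeff f n‖ := by
    have hfin : Summable fun n : Fin 2 → ℤ => if n = 0 then ‖cellCoeff f 0‖ else 0 :=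
      (hasSum_ite_eq 0 _).summable
    refine Summable.of_nonneg_of_le (fun n => by positivity) (fun n => ?_) (h.add hfin)
    rcases eq_or_ne n 0 with rfl | hn
    · simp
    · have : 1 ≤ ‖n‖ := by
        obtain ⟨i, hi⟩ := Function.ne_iff.1 hn
        refine le_trans ?_ (norm_le_pi_norm n i)
        rw [Int.norm_eq_abs]
        exact_mod_cast Int.one_le_abs hi
      simp only [hn, if_false, add_zero]
      nlinarith [norm_nonneg (cellCoeff f n)]
  have hcd : ContDiff ℝ 1 fun z => ∑' n, cellCoeff f n * planeChar n z := by
    refine contDiff_tsum (N := 1) (v := fun k n => if k = 0 then ‖cellCoeff f n‖ else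
      4 * Real.pi * (‖n‖ * ‖cellCoeff f n‖)) (fun n => contDiff_const.mul (contDiff_planeChar n))
      (fun k hk => ?_) fun k n z hk => ?_
    · rcases Nat.eq_zero_or_pos k with rfl | hk0
      · simpa using h0
      · simpa [hk0.ne'] using h.mul_left (4 * Real.pi)
    · have hk1 : k ≤ 1 := by exact_mod_cast hk
      interval_cases k
      · simp [norm_planeChar]
      · rw [norm_iteratedFDeriv_one, fderiv_const_mul
          ((contDiff_planeChar n (N := 1)).differentiable one_ne_zero z), norm_smul]
        simp only [one_ne_zero, if_false]
        calc _ ≤ ‖cellCoeff f n‖ * (4 * Real.pi * ‖n‖) := by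
              gcongr; exact norm_fderiv_planeChar_le n z
          _ = _ := by ring
  have hre : f = fun z => (∑' n, cellCoeff f n * planeChar n z).re := by
    ext z
    rw [(hasSum_cellCoeff_planeChar hc hp h0 z).tsum_eq, Complex.ofReal_re]
  rw [hre]
  exact Complex.reCLM.contDiff.comp hcd

/-- Interior regularity: a continuous curl-free field with divergence-free flux is continuously
differentiable when the coefficients are smooth. -/
lemma EllipticData.contDiff {l : ℝ} (h : EllipticData a b c p q l) (ha : ContDiff ℝ (⊤ : ℕ∞) a)
    (hb : ContDiff ℝ (⊤ : ℕ∞) b) (hc : ContDiff ℝ (⊤ : ℕ∞) c) :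
    ContDiff ℝ 1 p ∧ ContDiff ℝ 1 q := by
  have key : ∀ e : ℝ × ℝ, ∃ K, ∀ s : ℝ, 0 < s → diffEnergy s⁻¹ (s • e) p q 3 ≤ K := by
    intro e
    obtain ⟨Ma, hMa⟩ := exists_bound_diffQuot_iterate e ha h.pa 3
    obtain ⟨Mb, hMb⟩ := exists_bound_diffQuot_iterate e hb h.pb 3
    obtain ⟨Mc, hMc⟩ := exists_bound_diffQuot_iterate e hc h.pc 3
    obtain ⟨K, hK⟩ := h.exists_diffEnergy_le (max Ma (max Mb Mc)) 3
    exact ⟨K, fun s hs => hK _ _ (fun j hj z => ⟨(hMa s hs j hj z).trans (le_max_left _ _),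
      (hMb s hs j hj z).trans ((le_max_left _ _).trans (le_max_right _ _)),
      (hMc s hs j hj z).trans ((le_max_right _ _).trans (le_max_right _ _))⟩) 3 le_rfl⟩
  obtain ⟨K₁, hK₁⟩ := key (1, 0)
  obtain ⟨K₂, hK₂⟩ := key (0, 1)
  have hp : ∀ (r : ℝ) v, cellInt (fun z => ((diffQuot r v)^[3] p z) ^ 2) ≤ diffEnergy r v p q 3 :=
    fun r v => le_add_of_nonneg_right (cellInt_nonneg fun _ => sq_nonneg _)
  have hq : ∀ (r : ℝ) v, cellInt (fun z => ((diffQuot r v)^[3] q z) ^ 2) ≤ diffEnergy r v p q 3 :=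
    fun r v => le_add_of_nonneg_left (cellInt_nonneg fun _ => sq_nonneg _)
  exact ⟨contDiff_one_of_summable h.cp h.pp (summable_norm_mul_cellCoeff (K := max K₁ K₂) h.cp h.pp
      (fun s hs => (hp _ _).trans ((hK₁ s hs).trans (le_max_left _ _)))
      fun s hs => (hp _ _).trans ((hK₂ s hs).trans (le_max_right _ _))),
    contDiff_one_of_summable h.cq h.pq (summable_norm_mul_cellCoeff (K := max K₁ K₂) h.cq h.pq
      (fun s hs => (hq _ _).trans ((hK₁ s hs).trans (le_max_left _ _)))
      fun s hs => (hq _ _).trans ((hK₂ s hs).trans (le_max_right _ _)))⟩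

end Regularity

section Nonvanishing

open Filter Topology

variable {F₁ F₂ a b c p q u : ℝ × ℝ → ℝ}

lemma WeakDivFree.dx_add_dy_eq_zero (h : WeakDivFree F₁ F₂) (h₁ : ContDiff ℝ 1 F₁)
    (h₂ : ContDiff ℝ 1 F₂) (z : ℝ × ℝ) : dx F₁ z + dy F₂ z = 0 := by
  have c₁ := continuous_dx h₁
  have c₂ := continuous_dy h₂
  have hc : Continuous fun z => dx F₁ z + dy F₂ z := by fun_prop
  have hae := ae_eq_zero_of_integral_contDiff_smul_eq_zero (μ := volume) hc.locallyIntegrable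
    fun φ hφ hs => by
      have hφ1 : ContDiff ℝ 1 φ := hφ.of_le (by exact_mod_cast le_top)
      have c₃ := continuous_dx hφ1
      have c₄ := continuous_dy hφ1
      have c₅ := h₁.continuous
      have c₆ := h₂.continuous
      have c₇ := hφ1.continuous
      have e₁ := integral_mul_dx h₁ hφ1 hs
      have e₂ := integral_mul_dy h₂ hφ1 hs
      have e₃ := h φ hφ hs
      have i₁ : Integrable fun z => F₁ z * dx φ z :=
        Continuous.integrable_of_hasCompactSupport (by fun_prop) (hasCompactSupport_dx hs).mul_left
      have i₂ : Integrable fun z => F₂ z * dy φ z :=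
        Continuous.integrable_of_hasCompactSupport (by fun_prop) (hasCompactSupport_dy hs).mul_left
      have i₃ : Integrable fun z => dx F₁ z * φ z :=
        Continuous.integrable_of_hasCompactSupport (by fun_prop) hs.mul_left
      have i₄ : Integrable fun z => dy F₂ z * φ z :=
        Continuous.integrable_of_hasCompactSupport (by fun_prop) hs.mul_left
      rw [integral_add i₁ i₂, e₁, e₂] at e₃
      simp only [smul_eq_mul, mul_comm (φ _), add_mul]
      rw [integral_add i₃ i₄]
      linarith
  exact congrFun ((hc.ae_eq_iff_eq volume continuous_const (g := fun _ => (0 : ℝ))).1 hae) z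

lemma cellInt_jacobian_div_eq_zero (hp : ContDiff ℝ 1 p) (hq : ContDiff ℝ 1 q)
    (pp : IsPlanePeriodic p) (pq : IsPlanePeriodic q) {ε : ℝ} (hε : 0 < ε) :
    cellInt (fun z => (dx p z * dy q z - dy p z * dx q z) / (p z ^ 2 + q z ^ 2 + ε ^ 2)) = 0 := by
  set G : ℝ × ℝ → ℝ := fun w =>
    Real.arctan (w.1 / Real.sqrt (w.2 ^ 2 + ε ^ 2)) / Real.sqrt (w.2 ^ 2 + ε ^ 2) with hG
  have hpos : ∀ w : ℝ × ℝ, 0 < w.2 ^ 2 + ε ^ 2 := fun w => by positivity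
  have hs : ContDiff ℝ 1 fun w : ℝ × ℝ => Real.sqrt (w.2 ^ 2 + ε ^ 2) :=
    ContDiff.sqrt (by fun_prop) fun w => (hpos w).ne'
  have hs0 : ∀ w : ℝ × ℝ, Real.sqrt (w.2 ^ 2 + ε ^ 2) ≠ 0 := fun w =>
    (Real.sqrt_pos.2 (hpos w)).ne'
  have hGc : ContDiff ℝ 1 G :=
    (Real.contDiff_arctan.comp (contDiff_fst.div hs hs0)).div hs hs0
  have hGx : ∀ w, dx G w = 1 / (w.1 ^ 2 + w.2 ^ 2 + ε ^ 2) := fun w => by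
    refine dx_eq_of_hasDerivAt (hGc.differentiable one_ne_zero w) ?_
    have h := (((hasDerivAt_id w.1).div_const (Real.sqrt (w.2 ^ 2 + ε ^ 2))).arctan).div_const
      (Real.sqrt (w.2 ^ 2 + ε ^ 2))
    refine h.congr_deriv ?_
    have h2 := Real.sq_sqrt (hpos w).le
    have h3 := hs0 w
    have h4 := hpos w
    have h5 : w.1 ^ 2 + w.2 ^ 2 + ε ^ 2 ≠ 0 := by positivity
    simp only [id, div_pow, h2]
    have h6 : 1 + w.1 ^ 2 / (w.2 ^ 2 + ε ^ 2) =
        (w.1 ^ 2 + w.2 ^ 2 + ε ^ 2) / (w.2 ^ 2 + ε ^ 2) := by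
      field_simp
      ring
    rw [h6, one_div_div, div_mul_div_comm, div_div, mul_one, mul_assoc, ← sq, h2, mul_comm,
      ← div_div, div_self h4.ne']
  have hf : ContDiff ℝ 1 fun z => G (p z, q z) := hGc.comp (hp.prodMk hq)
  have hfd : ∀ z v, fderiv ℝ (fun z => G (p z, q z)) z v =
      fderiv ℝ p z v * dx G (p z, q z) + fderiv ℝ q z v * dy G (p z, q z) := fun z v => by
    have h := (hGc.differentiable one_ne_zero (p z, q z)).hasFDerivAt.comp z
      ((hp.differentiable one_ne_zero z).hasFDerivAt.prodMk
        (hq.differentiable one_ne_zero z).hasFDerivAt)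
    rw [← fderiv_eq_dx_dy]
    exact congrArg (fun L : ℝ × ℝ →L[ℝ] ℝ => L v) h.fderiv
  have pf : IsPlanePeriodic fun z => G (p z, q z) := pp.comp₂ pq fun s t => G (s, t)
  have h := cellInt_jacobian hf hq (isPlanePeriodic_dx pf) (isPlanePeriodic_dy pf)
    (isPlanePeriodic_dx pq) (isPlanePeriodic_dy pq)
  rw [cellInt_dx hf pf, cellInt_dy hf pf, zero_mul, zero_mul, sub_zero] at h
  rw [← h]
  congr 1
  ext z
  have e₁ : dx (fun z => G (p z, q z)) z = dx p z * dx G (p z, q z) + dx q z * dy G (p z, q z) :=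
    hfd z _
  have e₂ : dy (fun z => G (p z, q z)) z = dy p z * dx G (p z, q z) + dy q z * dy G (p z, q z) :=
    hfd z _
  rw [e₁, e₂, hGx]
  ring

/-- In dimension two, if the periodic gradient of a solution has a zero, then it has mean zero. -/
theorem cellInt_eq_zero_of_gradient_eq_zero (hu : ContDiff ℝ 1 u)
    (pp : IsPlanePeriodic (dx u)) (pq : IsPlanePeriodic (dy u))
    (ha : ContDiff ℝ (⊤ : ℕ∞) a) (hb : ContDiff ℝ (⊤ : ℕ∞) b) (hc : ContDiff ℝ (⊤ : ℕ∞) c)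
    (pa : IsPlanePeriodic a) (pb : IsPlanePeriodic b) (pc : IsPlanePeriodic c)
    (ha0 : ∀ z, 0 < a z) (hd0 : ∀ z, 0 < a z * c z - b z ^ 2)
    (h : WeakDivFree (fun z => a z * dx u z + b z * dy u z)
      (fun z => b z * dx u z + c z * dy u z))
    {z₀ : ℝ × ℝ} (hx0 : dx u z₀ = 0) (hy0 : dy u z₀ = 0) :
    cellInt (dx u) = 0 ∧ cellInt (dy u) = 0 := by
  have cp := continuous_dx hu
  have cq := continuous_dy hu
  have ca := ha.continuous
  have cb := hb.continuous
  have cc := hc.continuous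
  have hc0 : ∀ z, 0 < c z := fun z => by
    have := hd0 z
    have := ha0 z
    by_contra! h
    nlinarith [sq_nonneg (b z), mul_nonneg (ha0 z).le (neg_nonneg.2 h)]
  have hrot := weakDivFree_rotated_gradient hu
  obtain ⟨K, hK, hKb⟩ := (((pa.comp₂ pc (· * ·)).comp₂ pb fun u v => u - v ^ 2).comp₂
    (pa.comp₂ pc (· + ·)) fun u v => v / u).exists_bound
    (Continuous.div (by fun_prop) (by fun_prop) fun z => (hd0 z).ne')
  have hE : EllipticData a b c (dx u) (dy u) K⁻¹ :=
    { ca := ca, cb := cb, cc := cc, cp := cp, cq := cq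
      pa := pa, pb := pb, pc := pc, pp := pp, pq := pq
      pos := inv_pos.2 hK
      elliptic := fun z s t => by
        have hb := hKb z
        have h1 := ha0 z
        have h2 := hc0 z
        have h3 := hd0 z
        rw [abs_of_pos (div_pos (add_pos h1 h2) h3), div_le_iff₀ h3] at hb
        rw [inv_mul_le_iff₀ hK]
        have h4 : 0 < a z + c z := add_pos h1 h2
        have h5 : (a z * c z - b z ^ 2) * (s ^ 2 + t ^ 2) ≤
            (a z + c z) * (a z * s ^ 2 + 2 * b z * s * t + c z * t ^ 2) := by
          nlinarith [sq_nonneg (a z * s + b z * t), sq_nonneg (b z * s + c z * t)]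
        have h6 : 0 ≤ a z * s ^ 2 + 2 * b z * s * t + c z * t ^ 2 :=
          (mul_nonneg_iff_of_pos_left h4).1 (le_trans (by positivity) h5)
        have h7 : (a z * c z - b z ^ 2) * (s ^ 2 + t ^ 2) ≤ (a z * c z - b z ^ 2) *
            (K * (a z * s ^ 2 + 2 * b z * s * t + c z * t ^ 2)) := by
          nlinarith [mul_le_mul_of_nonneg_right hb h6]
        exact le_of_mul_le_mul_left h7 h3
      curl := hrot.fourierDivFree cq cp.neg pq (pp.comp₂ pp fun s _ => -s)
      div := h.fourierDivFree (by fun_prop) (by fun_prop)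
        ((pa.comp₂ pp (· * ·)).comp₂ (pb.comp₂ pq (· * ·)) (· + ·))
        ((pb.comp₂ pp (· * ·)).comp₂ (pc.comp₂ pq (· * ·)) (· + ·)) }
  obtain ⟨hp, hq⟩ := hE.contDiff ha hb hc
  have ha1 : ContDiff ℝ 1 a := ha.of_le (by exact_mod_cast le_top)
  have hb1 : ContDiff ℝ 1 b := hb.of_le (by exact_mod_cast le_top)
  have hc1 : ContDiff ℝ 1 c := hc.of_le (by exact_mod_cast le_top)
  have hcurl : ∀ z, dx (dy u) z = dy (dx u) z := fun z => by
    have := hrot.dx_add_dy_eq_zero hq hp.neg z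
    have e : dy (-dx u) z = -dy (dx u) z := by simp [dy, fderiv_neg]
    linarith
  have hprod : ∀ {f g : ℝ × ℝ → ℝ} (_ : ContDiff ℝ 1 f) (_ : ContDiff ℝ 1 g) (z v : ℝ × ℝ),
      fderiv ℝ (fun z => f z * g z) z v = f z * fderiv ℝ g z v + g z * fderiv ℝ f z v := by
    intro f g hf hg z v
    rw [fderiv_fun_mul (hf.differentiable one_ne_zero z) (hg.differentiable one_ne_zero z)]
    rfl
  have hsum : ∀ {f g r s : ℝ × ℝ → ℝ} (_ : ContDiff ℝ 1 f) (_ : ContDiff ℝ 1 g)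
      (_ : ContDiff ℝ 1 r) (_ : ContDiff ℝ 1 s) (z v : ℝ × ℝ),
      fderiv ℝ (fun z => f z * g z + r z * s z) z v = f z * fderiv ℝ g z v + g z * fderiv ℝ f z v +
        (r z * fderiv ℝ s z v + s z * fderiv ℝ r z v) := by
    intro f g r s hf hg hr hs z v
    rw [fderiv_fun_add ((hf.mul hg).differentiable one_ne_zero z)
      ((hr.mul hs).differentiable one_ne_zero z), _root_.add_apply, hprod hf hg,
      hprod hr hs]
  have hpde : ∀ z, a z * dx (dx u) z + 2 * b z * dy (dx u) z + c z * dy (dy u) z +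
      ((dx a z + dy b z) * dx u z + (dx b z + dy c z) * dy u z) = 0 := fun z => by
    have h1 := h.dx_add_dy_eq_zero ((ha1.mul hp).add (hb1.mul hq)) ((hb1.mul hp).add (hc1.mul hq)) z
    rw [dx, dy, hsum ha1 hp hb1 hq, hsum hb1 hp hc1 hq] at h1
    have h2 := hcurl z
    simp only [dx, dy] at h1 h2 ⊢
    linear_combination h1 - b z * h2
  have hz : ∀ z, dx u z = 0 ∧ dy u z = 0 := fun z =>
    eq_zero_of_elliptic hp hq pp pq ca cb cc ((continuous_dx ha1).add (continuous_dy hb1))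
      ((continuous_dx hb1).add (continuous_dy hc1)) pa pb pc
      ((isPlanePeriodic_dx pa).comp₂ (isPlanePeriodic_dy pb) (· + ·))
      ((isPlanePeriodic_dx pb).comp₂ (isPlanePeriodic_dy pc) (· + ·)) ha0 hd0 hcurl hpde
      (fun ε hε => cellInt_jacobian_div_eq_zero hp hq pp pq hε) hx0 hy0 z
  simp [cellInt, hz]

end Nonvanishing

/-- The Euclidean plane, in coordinates. -/
noncomputable def planeEquiv : (ℝ × ℝ) ≃L[ℝ] EuclideanSpace ℝ (Fin 2) :=
  (ContinuousLinearEquiv.finTwoArrow ℝ ℝ).symm.trans (EuclideanSpace.equiv (Fin 2) ℝ).symm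

section Plane

open Filter Topology

lemma planeEquiv_apply_zero (z : ℝ × ℝ) : planeEquiv z 0 = z.1 := rfl

lemma planeEquiv_apply_one (z : ℝ × ℝ) : planeEquiv z 1 = z.2 := rfl

lemma planeEquiv_fst : planeEquiv (1, 0) = EuclideanSpace.single 0 1 := by
  ext i; fin_cases i <;> simp [planeEquiv_apply_zero, planeEquiv_apply_one]

lemma planeEquiv_snd : planeEquiv (0, 1) = EuclideanSpace.single 1 1 := by
  ext i; fin_cases i <;> simp [planeEquiv_apply_zero, planeEquiv_apply_one]

lemma measurePreserving_planeEquiv : MeasurePreserving planeEquiv :=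
  (PiLp.volume_preserving_toLp (Fin 2)).comp (volume_preserving_finTwoArrow ℝ).symm

lemma measurableEmbedding_planeEquiv : MeasurableEmbedding planeEquiv :=
  planeEquiv.toHomeomorph.measurableEmbedding

lemma dx_comp_planeEquiv {f : EuclideanSpace ℝ (Fin 2) → ℝ} (z : ℝ × ℝ)
    (hf : DifferentiableAt ℝ f (planeEquiv z)) :
    dx (fun z => f (planeEquiv z)) z = fderiv ℝ f (planeEquiv z) (EuclideanSpace.single 0 1) := by
  rw [← planeEquiv_fst]
  exact congrArg (fun L : ℝ × ℝ →L[ℝ] ℝ => L (1, 0))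
    (hf.hasFDerivAt.comp z planeEquiv.hasFDerivAt).fderiv

lemma dy_comp_planeEquiv {f : EuclideanSpace ℝ (Fin 2) → ℝ} (z : ℝ × ℝ)
    (hf : DifferentiableAt ℝ f (planeEquiv z)) :
    dy (fun z => f (planeEquiv z)) z = fderiv ℝ f (planeEquiv z) (EuclideanSpace.single 1 1) := by
  rw [← planeEquiv_snd]
  exact congrArg (fun L : ℝ × ℝ →L[ℝ] ℝ => L (0, 1))
    (hf.hasFDerivAt.comp z planeEquiv.hasFDerivAt).fderiv

lemma gradient_apply_eq_fderiv_single {ι : Type*} [Fintype ι] [DecidableEq ι]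
    (f : EuclideanSpace ℝ ι → ℝ) (x : EuclideanSpace ℝ ι) (i : ι) :
    gradient f x i = fderiv ℝ f x (EuclideanSpace.single i 1) := by
  have h : inner ℝ (gradient f x) (EuclideanSpace.single i (1 : ℝ)) =
      fderiv ℝ f x (EuclideanSpace.single i 1) := InnerProductSpace.toDual_symm_apply
  rw [← h, EuclideanSpace.inner_single_right]
  simp

lemma isPlanePeriodic_comp_planeEquiv {α : Type*} {f : EuclideanSpace ℝ (Fin 2) → α}
    (hf : ∀ (x : EuclideanSpace ℝ (Fin 2)) (k : Fin 2 → ℤ),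
      f (x + (WithLp.equiv 2 (Fin 2 → ℝ)).symm (fun i => (k i : ℝ))) = f x) :
    IsPlanePeriodic fun z => f (planeEquiv z) := by
  intro x y
  constructor
  · refine Eq.trans (congrArg f ?_) (hf (planeEquiv (x, y)) ![1, 0])
    ext i
    fin_cases i <;> simp [planeEquiv_apply_zero, planeEquiv_apply_one]
  · refine Eq.trans (congrArg f ?_) (hf (planeEquiv (x, y)) ![0, 1])
    ext i
    fin_cases i <;> simp [planeEquiv_apply_zero, planeEquiv_apply_one]

lemma setIntegral_cube_eq_cellInt (f : EuclideanSpace ℝ (Fin 2) → ℝ) :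
    ∫ x in {x : EuclideanSpace ℝ (Fin 2) | ∀ i, x i ∈ Set.Icc (0 : ℝ) 1}, f x =
      cellInt fun z => f (planeEquiv z) := by
  rw [← measurePreserving_planeEquiv.setIntegral_preimage_emb measurableEmbedding_planeEquiv]
  refine setIntegral_congr_set ?_
  have h : planeEquiv ⁻¹' {x : EuclideanSpace ℝ (Fin 2) | ∀ i, x i ∈ Set.Icc (0 : ℝ) 1} =
      Set.Icc (0 : ℝ) 1 ×ˢ Set.Icc (0 : ℝ) 1 := by
    ext z
    simp only [Set.mem_preimage, Set.mem_ofPred_eq, Fin.forall_fin_two, Set.mem_prod]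
    rfl
  rw [h]
  exact Measure.set_prod_ae_eq Ioc_ae_eq_Icc.symm Ioc_ae_eq_Icc.symm

lemma WeakDivFree.const_mul_add_const_mul {F₁ F₂ G₁ G₂ : ℝ × ℝ → ℝ} (hF : WeakDivFree F₁ F₂)
    (hG : WeakDivFree G₁ G₂) (cF₁ : Continuous F₁) (cF₂ : Continuous F₂) (cG₁ : Continuous G₁)
    (cG₂ : Continuous G₂) (s t : ℝ) :
    WeakDivFree (fun z => s * F₁ z + t * G₁ z) (fun z => s * F₂ z + t * G₂ z) := by
  intro φ hφ hs
  have hφ1 : ContDiff ℝ 1 φ := hφ.of_le (by exact_mod_cast le_top)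
  have c₁ := continuous_dx hφ1
  have c₂ := continuous_dy hφ1
  have key : ∀ {H₁ H₂ : ℝ × ℝ → ℝ}, Continuous H₁ → Continuous H₂ →
      Integrable fun z => H₁ z * dx φ z + H₂ z * dy φ z := fun k₁ k₂ =>
    (Continuous.integrable_of_hasCompactSupport (by fun_prop)
      (hasCompactSupport_dx hs).mul_left).add (Continuous.integrable_of_hasCompactSupport
      (by fun_prop) (hasCompactSupport_dy hs).mul_left)
  have h := integral_add ((key cF₁ cF₂).const_mul s) ((key cG₁ cG₂).const_mul t)
  rw [integral_const_mul, integral_const_mul, hF φ hφ hs, hG φ hφ hs, mul_zero, mul_zero,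
    add_zero] at h
  rw [← h]
  congr 1
  ext z
  ring

end Plane

section PlaneGrad

variable {U : EuclideanSpace ℝ (Fin 2) → EuclideanSpace ℝ (Fin 2)}

lemma contDiff_coord_planeEquiv (hU : ContDiff ℝ 1 U) (j : Fin 2) :
    ContDiff ℝ 1 fun z => U (planeEquiv z) j :=
  (contDiff_euclidean.1 hU j).comp planeEquiv.contDiff

lemma dx_coord_planeEquiv (hU : ContDiff ℝ 1 U) (j : Fin 2) :
    dx (fun z => U (planeEquiv z) j) = fun z => matGrad U (planeEquiv z) 0 j :=
  funext fun z => dx_comp_planeEquiv (f := fun x => U x j) z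
    ((contDiff_euclidean.1 hU j).differentiable one_ne_zero _)

lemma dy_coord_planeEquiv (hU : ContDiff ℝ 1 U) (j : Fin 2) :
    dy (fun z => U (planeEquiv z) j) = fun z => matGrad U (planeEquiv z) 1 j :=
  funext fun z => dy_comp_planeEquiv (f := fun x => U x j) z
    ((contDiff_euclidean.1 hU j).differentiable one_ne_zero _)

lemma fderiv_comb_planeEquiv (hU : ContDiff ℝ 1 U) (ξ : Fin 2 → ℝ) (z v : ℝ × ℝ) :
    fderiv ℝ (fun z => ξ 0 * U (planeEquiv z) 0 + ξ 1 * U (planeEquiv z) 1) z v =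
      ξ 0 * fderiv ℝ (fun z => U (planeEquiv z) 0) z v +
        ξ 1 * fderiv ℝ (fun z => U (planeEquiv z) 1) z v := by
  have h0 := (contDiff_coord_planeEquiv hU 0).differentiable one_ne_zero z
  have h1 := (contDiff_coord_planeEquiv hU 1).differentiable one_ne_zero z
  rw [fderiv_fun_add (h0.const_mul _) (h1.const_mul _), fderiv_const_mul h0, fderiv_const_mul h1]
  rfl

end PlaneGrad

/-- **Theorem 3.1(ii)**: in dimension two, if `DU` is `ℤ²`-periodic with `det⟨DU⟩ ≠ 0` and is a
realizable matrix electric field for a smooth `ℤ²`-periodic symmetric positive definite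
conductivity `σ` (i.e. `Div(σ DU) = 0` in the sense of distributions), then
`det(⟨DU⟩ ⬝ DU(x)) > 0` everywhere. -/
theorem positive_determinant_of_realizable_2d
    (U : EuclideanSpace ℝ (Fin 2) → EuclideanSpace ℝ (Fin 2)) (hU : ContDiff ℝ 1 U)
    (hper : ∀ (x : EuclideanSpace ℝ (Fin 2)) (k : Fin 2 → ℤ),
      matGrad U (x + (WithLp.equiv 2 (Fin 2 → ℝ)).symm (fun i => (k i : ℝ))) = matGrad U x)
    (A : Matrix (Fin 2) (Fin 2) ℝ)
    (hA : ∀ i j, A i j = ∫ x in {x : EuclideanSpace ℝ (Fin 2) | ∀ i', x i' ∈ Set.Icc (0:ℝ) 1},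
      matGrad U x i j)
    (hAdet : A.det ≠ 0)
    (σ : EuclideanSpace ℝ (Fin 2) → Matrix (Fin 2) (Fin 2) ℝ)
    (hσsmooth : ∀ i j, ContDiff ℝ (⊤ : ℕ∞) fun x => σ x i j)
    (hσper : ∀ (x : EuclideanSpace ℝ (Fin 2)) (k : Fin 2 → ℤ),
      σ (x + (WithLp.equiv 2 (Fin 2 → ℝ)).symm (fun i => (k i : ℝ))) = σ x)
    (hσsym : ∀ x, (σ x).IsSymm)
    (hσpos : ∀ x, (σ x).PosDef)
    (hdiv : ∀ (j : Fin 2) (φ : EuclideanSpace ℝ (Fin 2) → ℝ),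
      ContDiff ℝ (⊤ : ℕ∞) φ → HasCompactSupport φ →
      (∫ x : EuclideanSpace ℝ (Fin 2),
        ∑ i, (σ x *ᵥ fun i' => matGrad U x i' j) i * gradient φ x i) = 0) :
    ∀ x, 0 < (A * matGrad U x).det := by
  set M : ℝ × ℝ → Matrix (Fin 2) (Fin 2) ℝ := fun z => matGrad U (planeEquiv z) with hM
  have hu := contDiff_coord_planeEquiv hU
  have hdx : ∀ j, dx (fun z => U (planeEquiv z) j) = fun z => M z 0 j := dx_coord_planeEquiv hU
  have hdy : ∀ j, dy (fun z => U (planeEquiv z) j) = fun z => M z 1 j := dy_coord_planeEquiv hU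
  have hMp : IsPlanePeriodic M := isPlanePeriodic_comp_planeEquiv hper
  have hMc : ∀ i j, Continuous fun z => M z i j := fun i j => by
    fin_cases i
    · exact hdx j ▸ continuous_dx (hu j)
    · exact hdy j ▸ continuous_dy (hu j)
  have hAM : ∀ i j, A i j = cellInt fun z => M z i j := fun i j =>
    (hA i j).trans (setIntegral_cube_eq_cellInt _)
  set S : ℝ × ℝ → Matrix (Fin 2) (Fin 2) ℝ := fun z => σ (planeEquiv z) with hS
  have hSp : IsPlanePeriodic S := isPlanePeriodic_comp_planeEquiv hσper
  have hSs : ∀ i j, ContDiff ℝ (⊤ : ℕ∞) fun z => S z i j := fun i j =>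
    (hσsmooth i j).comp planeEquiv.contDiff
  have hSc : ∀ i j, Continuous fun z => S z i j := fun i j => (hSs i j).continuous
  have hSsym : ∀ z, S z 1 0 = S z 0 1 := fun z => (hσsym (planeEquiv z)).apply 0 1
  have hS0 : ∀ z, 0 < S z 0 0 := fun z => (hσpos (planeEquiv z)).diag_pos
  have hSd : ∀ z, 0 < S z 0 0 * S z 1 1 - S z 0 1 ^ 2 := fun z => by
    have h := (hσpos (planeEquiv z)).det_pos
    rw [Matrix.det_fin_two] at h
    have h' : 0 < S z 0 0 * S z 1 1 - S z 0 1 * S z 1 0 := h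
    rw [hSsym] at h'
    rwa [sq]
  have hweak : ∀ j, WeakDivFree (fun z => S z 0 0 * M z 0 j + S z 0 1 * M z 1 j)
      (fun z => S z 0 1 * M z 0 j + S z 1 1 * M z 1 j) := by
    intro j φ hφ hs
    have hψ : ContDiff ℝ (⊤ : ℕ∞) fun x => φ (planeEquiv.symm x) :=
      hφ.comp planeEquiv.symm.contDiff
    have h := hdiv j _ hψ (hs.comp_homeomorph planeEquiv.symm.toHomeomorph)
    rw [← measurePreserving_planeEquiv.integral_comp measurableEmbedding_planeEquiv] at h
    rw [← h]
    congr 1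
    ext z
    have hd : DifferentiableAt ℝ (fun x => φ (planeEquiv.symm x)) (planeEquiv z) :=
      hψ.differentiable (by simp) _
    have e0 := dx_comp_planeEquiv z hd
    have e1 := dy_comp_planeEquiv z hd
    simp only [ContinuousLinearEquiv.symm_apply_apply] at e0 e1
    rw [Fin.sum_univ_two, gradient_apply_eq_fderiv_single, gradient_apply_eq_fderiv_single,
      ← e0, ← e1]
    simp only [Matrix.mulVec, dotProduct, Fin.sum_univ_two]
    rw [show σ (planeEquiv z) 1 0 = S z 0 1 from hSsym z]
  have hne : ∀ z, (M z).det ≠ 0 := by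
    intro z hz
    obtain ⟨ξ, hξ, hξz⟩ := Matrix.exists_mulVec_eq_zero_iff.2 hz
    have hcd : ContDiff ℝ 1 fun z => ξ 0 * U (planeEquiv z) 0 + ξ 1 * U (planeEquiv z) 1 :=
      (contDiff_const.mul (hu 0)).add (contDiff_const.mul (hu 1))
    have hx : dx (fun z => ξ 0 * U (planeEquiv z) 0 + ξ 1 * U (planeEquiv z) 1) =
        fun z => ξ 0 * M z 0 0 + ξ 1 * M z 0 1 := by
      ext z
      rw [← congrFun (hdx 0) z, ← congrFun (hdx 1) z]
      exact fderiv_comb_planeEquiv hU ξ z _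
    have hy : dy (fun z => ξ 0 * U (planeEquiv z) 0 + ξ 1 * U (planeEquiv z) 1) =
        fun z => ξ 0 * M z 1 0 + ξ 1 * M z 1 1 := by
      ext z
      rw [← congrFun (hdy 0) z, ← congrFun (hdy 1) z]
      exact fderiv_comb_planeEquiv hU ξ z _
    have hw : ∀ i, ξ 0 * M z i 0 + ξ 1 * M z i 1 = 0 := fun i => by
      have := congrFun hξz i
      simp only [Matrix.mulVec, dotProduct, Fin.sum_univ_two, Pi.zero_apply] at this
      linarith
    have hmean := cellInt_eq_zero_of_gradient_eq_zero hcd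
      (hx ▸ hMp.comp₂ hMp fun m _ => ξ 0 * m 0 0 + ξ 1 * m 0 1)
      (hy ▸ hMp.comp₂ hMp fun m _ => ξ 0 * m 1 0 + ξ 1 * m 1 1)
      (hSs 0 0) (hSs 0 1) (hSs 1 1) (hSp.comp₂ hSp fun m _ => m 0 0)
      (hSp.comp₂ hSp fun m _ => m 0 1) (hSp.comp₂ hSp fun m _ => m 1 1) hS0 hSd
      (by
        have c := hMc
        have c' := hSc
        have h := (hweak 0).const_mul_add_const_mul (hweak 1) (by fun_prop) (by fun_prop)
          (by fun_prop) (by fun_prop) (ξ 0) (ξ 1)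
        rw [hx, hy]
        convert h using 1 <;> (ext z; ring))
      (z₀ := z) (by rw [hx]; exact hw 0) (by rw [hy]; exact hw 1)
    rw [hx, hy] at hmean
    have hAξ : ∀ i, cellInt (fun z => ξ 0 * M z i 0 + ξ 1 * M z i 1) = (A *ᵥ ξ) i := fun i => by
      rw [cellInt_add ((hMc i 0).const_mul _) ((hMc i 1).const_mul _), cellInt_const_mul,
        cellInt_const_mul, ← hAM, ← hAM]
      simp only [Matrix.mulVec, dotProduct, Fin.sum_univ_two]
      ring
    rw [hAξ, hAξ] at hmean
    refine hAdet (Matrix.exists_mulVec_eq_zero_iff.1 ⟨ξ, hξ, ?_⟩)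
    ext i
    fin_cases i
    exacts [hmean.1, hmean.2]
  have hdet : ∀ z, (M z).det = M z 0 0 * M z 1 1 - M z 1 0 * M z 0 1 := fun z => by
    rw [Matrix.det_fin_two]; ring
  have hdetc : Continuous fun z => A.det * (M z).det := by
    have c := hMc
    simp only [hdet]
    fun_prop
  have hmean : cellInt (fun z => A.det * (M z).det) = A.det * A.det := by
    have hp : ∀ i j, IsPlanePeriodic fun z => M z i j := fun i j => hMp.comp₂ hMp fun m _ => m i j
    have h := cellInt_jacobian (hu 0) (hu 1) (hdx 0 ▸ hp 0 0) (hdy 0 ▸ hp 1 0) (hdx 1 ▸ hp 0 1)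
      (hdy 1 ▸ hp 1 1)
    rw [hdx, hdx, hdy, hdy, ← hAM, ← hAM, ← hAM, ← hAM] at h
    rw [cellInt_const_mul]
    simp only [hdet]
    rw [h, Matrix.det_fin_two]
    ring
  intro x
  obtain ⟨z, rfl⟩ := planeEquiv.surjective x
  rw [Matrix.det_mul]
  by_contra! hneg
  have hall : ∀ w, A.det * (M w).det ≤ 0 := by
    intro w
    by_contra! hw
    obtain ⟨y, hy⟩ := mem_range_of_exists_le_of_exists_ge hdetc ⟨z, hneg⟩ ⟨w, hw.le⟩
    exact mul_ne_zero hAdet (hne y) hy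
  have h := cellInt_mono hdetc continuous_const hall
  rw [hmean, cellInt_const] at h
  exact absurd h (not_le.2 (mul_self_pos.2 hAdet))
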